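/- For every x ∈ (1, x_KL), the following chain of inequalities holds (Hausdorff dimension of subsets of ℝ with respect to the Euclidean metric): 0 < dim_H 𝒰_{q_x} ≤ dim_H 𝒰(x) ≤ sup_{q ∈ cl(𝒰(x))} dim_H 𝒰_q < 1, where cl(𝒰(x)) is the topological closure of 𝒰(x). In particular 0 < dim_H 𝒰(x) < 1. -/

import Mathlib

open scoped ENNReal NNReal Classical

namespace Expansions

/-- Digit sequences over the alphabet `{0,1,…,M}`; index `i : ℕ` represents the
`(i+1)`-st digit `d_{i+1}` of the paper. -/
abbrev Digits (M : ℕ) := ℕ → Fin (M + 1)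

/-- `π_q((d_i)) = Σ_{i≥1} d_i / q^i`. -/
noncomputable def piQ (M : ℕ) (q : ℝ) (d : Digits M) : ℝ :=
  ∑' i : ℕ, (d i : ℝ) / q ^ (i + 1)

/-- `𝒰_q` : the set of real numbers having a unique `q`-expansion. -/
def Uq (M : ℕ) (q : ℝ) : Set ℝ := {x | ∃! d : Digits M, piQ M q d = x}

/-- `𝐔_q` : the set of sequences that are the unique `q`-expansion of their value. -/
def UqSym (M : ℕ) (q : ℝ) : Set (Digits M) :=
  {d | ∀ e : Digits M, piQ M q e = piQ M q d → e = d}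

/-- `𝒰(x)` : the set of univoque bases of `x`. -/
def Ubases (M : ℕ) (x : ℝ) : Set ℝ :=
  {q | q ∈ Set.Ioc (1 : ℝ) ((M : ℝ) + 1) ∧ x ∈ Uq M q}

/-- `q_x = min{M+1, 1+M/x}`. -/
noncomputable def qx (M : ℕ) (x : ℝ) : ℝ := min ((M : ℝ) + 1) (1 + (M : ℝ) / x)

/-- Strict lexicographic order on digit sequences. -/
def lexLt {M : ℕ} (c d : Digits M) : Prop := ∃ n, (∀ i < n, c i = d i) ∧ c n < d n

def lexLe {M : ℕ} (c d : Digits M) : Prop := c = d ∨ lexLt c d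

/-- The sequence ends with `0^∞`. -/
def EndsInZero {M : ℕ} (d : Digits M) : Prop := ∃ N, ∀ n ≥ N, d n = 0

/-- `d` is the quasi-greedy `q`-expansion of `x`: the lexicographically largest
`q`-expansion of `x` not ending with `0^∞`. -/
def IsQuasiGreedy (M : ℕ) (q x : ℝ) (d : Digits M) : Prop :=
  piQ M q d = x ∧ ¬ EndsInZero d ∧
    ∀ e : Digits M, piQ M q e = x → ¬ EndsInZero e → lexLe e d

/-- `Φ_x(q)`: the quasi-greedy `q`-expansion of `x` (junk value if none exists). -/
noncomputable def Phi (M : ℕ) (x q : ℝ) : Digits M :=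
  if h : ∃ d : Digits M, IsQuasiGreedy M q x d then h.choose else fun _ => 0

/-- `𝐔(x) = {Φ_x(q) : q ∈ 𝒰(x)}`. -/
def UxSym (M : ℕ) (x : ℝ) : Set (Digits M) := (Phi M x) '' (Ubases M x)

/-- `ρ((c_i),(d_i)) = (M+1)^{-inf{i ≥ 1 : c_i ≠ d_i}}` (our index `n` represents the
`(n+1)`-st digit, whence the exponent `-(n+1)`); `ρ(c,c) = 0`. -/
noncomputable def rho (M : ℕ) (c d : Digits M) : ℝ :=
  if c = d then 0
  else ((M : ℝ) + 1) ^ (-(((sInf {i | c i ≠ d i} : ℕ) : ℤ) + 1))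

/-- Diameter of a set with respect to a distance function, valued in `ℝ≥0∞`. -/
noncomputable def gdiam {X : Type*} (dist : X → X → ℝ) (A : Set X) : ℝ≥0∞ :=
  ⨆ x ∈ A, ⨆ y ∈ A, ENNReal.ofReal (dist x y)

/-- The `s`-dimensional Hausdorff outer measure with respect to a distance function:
`lim_{δ→0⁺} inf {Σ diam(C n)^s : A ⊆ ⋃ C n, diam (C n) ≤ δ}`. -/
noncomputable def gHMeasure {X : Type*} (dist : X → X → ℝ) (s : ℝ) (A : Set X) : ℝ≥0∞ :=
  ⨆ (δ : ℝ) (_ : 0 < δ),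
    ⨅ (C : ℕ → Set X) (_ : A ⊆ ⋃ n, C n)
      (_ : ∀ n, gdiam dist (C n) ≤ ENNReal.ofReal δ),
      ∑' n, gdiam dist (C n) ^ s

/-- Hausdorff dimension with respect to a distance function. -/
noncomputable def gdimH {X : Type*} (dist : X → X → ℝ) (A : Set X) : ℝ≥0∞ :=
  ⨆ (s : ℝ≥0) (_ : gHMeasure dist (s : ℝ) A = ⊤), (s : ℝ≥0∞)

/-- The generalized golden ratio `q_G`. -/
noncomputable def qG (M : ℕ) : ℝ :=
  if M % 2 = 0 then ((M / 2 : ℕ) : ℝ) + 1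
  else (((M / 2 : ℕ) : ℝ) + 1 +
    Real.sqrt (((M / 2 : ℕ) : ℝ) ^ 2 + 6 * ((M / 2 : ℕ) : ℝ) + 5)) / 2

/-- `x_G = M/(q_G - 1)`. -/
noncomputable def xG (M : ℕ) : ℝ := (M : ℝ) / (qG M - 1)

/-- The Komornik–Loreti constant `q_KL = min 𝒰(1)`. -/
noncomputable def qKL (M : ℕ) : ℝ := sInf (Ubases M 1)

/-- `x_KL = M/(q_KL - 1)`. -/
noncomputable def xKL (M : ℕ) : ℝ := (M : ℝ) / (qKL M - 1)

/-- `X_iso`: the set of `x > 0` such that `𝒰(x)` contains an isolated point. -/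
def Xiso (M : ℕ) : Set ℝ :=
  {x | 0 < x ∧ ∃ q ∈ Ubases M x, ∃ ε > 0, Ubases M x ∩ Set.Ioo (q - ε) (q + ε) = {q}}

/-- The bifurcation set `𝒱 = {q ∈ (1,M+1] : 𝐔_r ≠ 𝐔_q for all r > q}`. -/
def Vset (M : ℕ) : Set ℝ :=
  {q | q ∈ Set.Ioc (1 : ℝ) ((M : ℝ) + 1) ∧
    ∀ r ∈ Set.Ioc (1 : ℝ) ((M : ℝ) + 1), q < r → UqSym M r ≠ UqSym M q}

/-- The Thue–Morse sequence `τ_i` = parity of the binary digit sum of `i`. -/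
def tm (i : ℕ) : ℕ := (Nat.digits 2 i).sum % 2

section

variable {M : ℕ}

/-! ### Shifts, reflections and the lexicographic order -/

/-- Drop the first `n` digits. -/
def shift (n : ℕ) (d : Digits M) : Digits M := fun i => d (i + n)

/-- The digitwise reflection `d ↦ M - d`. -/
def mirror (d : Digits M) : Digits M := fun i => Fin.rev (d i)

@[simp] lemma shift_apply (n i : ℕ) (d : Digits M) : shift n d i = d (i + n) := rfl

@[simp] lemma shift_zero (d : Digits M) : shift 0 d = d := rfl

lemma shift_shift (m n : ℕ) (d : Digits M) : shift m (shift n d) = shift (m + n) d := by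
  funext i; simp [add_assoc]

@[simp] lemma mirror_apply (i : ℕ) (d : Digits M) : mirror d i = Fin.rev (d i) := rfl

@[simp] lemma mirror_mirror (d : Digits M) : mirror (mirror d) = d := by
  funext i; simp

lemma mirror_shift (n : ℕ) (d : Digits M) : mirror (shift n d) = shift n (mirror d) := rfl

lemma val_mirror (i : ℕ) (d : Digits M) : ((mirror d i : ℕ) : ℝ) = M - d i := by
  have h := (d i).is_lt
  simp only [mirror_apply, Fin.val_rev]
  rw [Nat.cast_sub (by omega)]
  push_cast; ring

lemma lexLt_iff {c d : Digits M} : lexLt c d ↔ toLex c < toLex d := Iff.rfl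

lemma lexLe_iff {c d : Digits M} : lexLe c d ↔ toLex c ≤ toLex d := by
  rw [le_iff_eq_or_lt]; rfl

lemma lexLe_refl (c : Digits M) : lexLe c c := Or.inl rfl

lemma lexLt.le {c d : Digits M} (h : lexLt c d) : lexLe c d := Or.inr h

lemma lexLe.trans {a b c : Digits M} (h : lexLe a b) (h' : lexLe b c) : lexLe a c := by
  rw [lexLe_iff] at *; exact h.trans h'

lemma lexLt.trans_le {a b c : Digits M} (h : lexLt a b) (h' : lexLe b c) : lexLt a c := by
  rw [lexLe_iff] at *; exact lt_of_lt_of_le (lexLt_iff.1 h) h'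

lemma lexLe.trans_lt {a b c : Digits M} (h : lexLe a b) (h' : lexLt b c) : lexLt a c := by
  rw [lexLe_iff] at *; exact lt_of_le_of_lt h (lexLt_iff.1 h')

lemma not_lexLe {a b : Digits M} : ¬ lexLe a b ↔ lexLt b a := by
  rw [lexLe_iff, not_le]; rfl

lemma not_lexLt {a b : Digits M} : ¬ lexLt a b ↔ lexLe b a := by
  rw [← not_lexLe, not_not]

lemma lexLt_irrefl (a : Digits M) : ¬ lexLt a a := not_lexLt.2 (lexLe_refl a)

lemma mirror_lexLt {c d : Digits M} : lexLt (mirror c) (mirror d) ↔ lexLt d c := by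
  simp only [lexLt, mirror_apply, Fin.rev_inj, Fin.rev_lt_rev]
  exact exists_congr fun n => and_congr_left' (forall₂_congr fun i _ => eq_comm)

lemma mirror_lexLe {c d : Digits M} : lexLe (mirror c) (mirror d) ↔ lexLe d c := by
  rw [← not_lexLt, ← not_lexLt, mirror_lexLt]

lemma lexLt_mirror_comm {c d : Digits M} : lexLt (mirror c) d ↔ lexLt (mirror d) c := by
  rw [← mirror_lexLt, mirror_mirror]

lemma lexLe_mirror_comm {c d : Digits M} : lexLe (mirror c) d ↔ lexLe (mirror d) c := by
  rw [← mirror_lexLe, mirror_mirror]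

lemma lexLe_shift_of_zero (d : Digits M) (l n : ℕ) (h : ∀ i, l ≤ i → i < l + n → d i = 0) :
    lexLe (shift l d) (shift (l + n) d) := by
  induction n with
  | zero => exact lexLe_refl _
  | succ n ih =>
    refine (ih fun i h1 h2 => h i h1 (by omega)).trans ?_
    rw [← not_lexLt]
    rintro ⟨k, hk, hk'⟩
    have : ∀ i ≤ k, d (i + (l + n)) = 0 := by
      intro i hi
      induction i with
      | zero => exact h _ (by omega) (by omega)
      | succ i ihi =>
        have := hk i (by omega)
        simp only [shift_apply] at this
        rw [← ihi (by omega), ← this]; congr 1; ring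
    simp only [shift_apply, this k le_rfl] at hk'
    exact absurd hk' (Fin.not_lt_zero _)

/-! ### Values of digit sequences -/

lemma summable_piQ {q : ℝ} (hq : 1 < q) (d : Digits M) :
    Summable fun i : ℕ => (d i : ℝ) / q ^ (i + 1) := by
  have h : Summable fun i : ℕ => (M : ℝ) * (1 / q) ^ (i + 1) :=
    ((summable_nat_add_iff 1).2
      (summable_geometric_of_lt_one (by positivity) (by rw [div_lt_one] <;> linarith))).mul_left _
  refine h.of_nonneg_of_le (fun i => by positivity) fun i => ?_
  rw [one_div, inv_pow, ← div_eq_mul_inv]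
  gcongr
  exact_mod_cast Nat.lt_succ_iff.1 (d i).is_lt

lemma piQ_nonneg {q : ℝ} (hq : 1 < q) (d : Digits M) : 0 ≤ piQ M q d :=
  tsum_nonneg fun i => by positivity

lemma piQ_cons {q : ℝ} (hq : 1 < q) (d : Digits M) :
    q * piQ M q d = d 0 + piQ M q (shift 1 d) := by
  have h0 : q ≠ 0 := by positivity
  unfold piQ
  rw [(summable_piQ hq d).tsum_eq_zero_add, mul_add, ← tsum_mul_left]
  congr 1
  · simp; field_simp
  · refine tsum_congr fun i => ?_
    simp only [shift_apply]; field_simp; ring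

lemma piQ_const_top {q : ℝ} (hq : 1 < q) : piQ M q (fun _ => Fin.last M) = M / (q - 1) := by
  have := piQ_cons hq (M := M) (fun _ => Fin.last M)
  have h1 : q - 1 ≠ 0 := by linarith
  have e : shift 1 (fun _ => Fin.last M) = fun _ => Fin.last M := rfl
  rw [e] at this
  simp only [Fin.val_last] at this
  field_simp
  linarith

lemma piQ_mirror {q : ℝ} (hq : 1 < q) (d : Digits M) :
    piQ M q (mirror d) = M / (q - 1) - piQ M q d := by
  rw [← piQ_const_top hq]
  unfold piQ
  rw [← (summable_piQ hq _).tsum_sub (summable_piQ hq _)]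
  refine tsum_congr fun i => ?_
  rw [val_mirror, Fin.val_last]; ring

lemma piQ_le {q : ℝ} (hq : 1 < q) (d : Digits M) : piQ M q d ≤ M / (q - 1) := by
  have := piQ_mirror hq d
  have := piQ_nonneg hq (mirror d)
  linarith

lemma piQ_sub_piQ {q : ℝ} (hq : 1 < q) {c d : Digits M} {n : ℕ} (h : ∀ i < n, c i = d i) :
    piQ M q c - piQ M q d = (piQ M q (shift n c) - piQ M q (shift n d)) / q ^ n := by
  have h0 : q ≠ 0 := by positivity
  induction n generalizing c d with
  | zero => simp
  | succ n ih =>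
    have h1 := ih (c := shift 1 c) (d := shift 1 d) fun i hi => h (i + 1) (by omega)
    rw [shift_shift, shift_shift] at h1
    have h2 := piQ_cons hq c
    have h3 := piQ_cons hq d
    rw [h 0 (by omega)] at h2
    have : piQ M q c - piQ M q d = (piQ M q (shift 1 c) - piQ M q (shift 1 d)) / q := by
      field_simp; linarith
    rw [this, h1]; field_simp; ring

/-- The value of a sequence when the expansion is truncated. -/
lemma piQ_sub_piQ_of_ne {q : ℝ} (hq : 1 < q) {c d : Digits M} {n : ℕ} (h : ∀ i < n, c i = d i) :
    q ^ (n + 1) * (piQ M q c - piQ M q d) =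
      (c n : ℝ) - d n + piQ M q (shift (n + 1) c) - piQ M q (shift (n + 1) d) := by
  have h0 : q ≠ 0 := by positivity
  have h1 := piQ_sub_piQ hq h
  have h2 := piQ_cons hq (shift n c)
  have h3 := piQ_cons hq (shift n d)
  rw [shift_shift, add_comm 1 n] at h2 h3
  simp only [shift_apply, zero_add] at h2 h3
  have e : ∀ A : ℝ, q ^ (n + 1) * (A / q ^ n) = q * A := fun A => by
    rw [pow_succ]; field_simp
  rw [h1, e]; linarith

lemma piQ_scale {q q' : ℝ} (hq : 1 < q) (hqq : q ≤ q') (d : Digits M) :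
    q' * piQ M q' d ≤ q * piQ M q d := by
  unfold piQ
  rw [← tsum_mul_left, ← tsum_mul_left]
  refine Summable.tsum_le_tsum (fun i => ?_) ((summable_piQ (hq.trans_le hqq) d).mul_left _)
    ((summable_piQ hq d).mul_left _)
  have h0 : q ≠ 0 := by positivity
  have h0' : q' ≠ 0 := by linarith
  have e : ∀ r : ℝ, r ≠ 0 → r * ((d i : ℝ) / r ^ (i + 1)) = (d i : ℝ) / r ^ i := by
    intro r hr; field_simp; ring
  rw [e _ h0, e _ h0']
  gcongr

lemma piQ_anti {q q' : ℝ} (hq : 1 < q) (hqq : q ≤ q') (d : Digits M) :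
    piQ M q' d ≤ piQ M q d := by
  have h1 := piQ_scale hq hqq d
  have h2 := piQ_nonneg (hq.trans_le hqq) d
  nlinarith

lemma piQ_sub_le {q q' : ℝ} (hq : 1 < q) (hqq : q ≤ q') (d : Digits M) :
    piQ M q d - piQ M q' d ≤ M / (q - 1) - M / (q' - 1) := by
  have h1 := piQ_anti hq hqq (mirror d)
  rw [piQ_mirror hq, piQ_mirror (hq.trans_le hqq)] at h1
  linarith

lemma continuousOn_piQ (d : Digits M) : ContinuousOn (fun q => piQ M q d) (Set.Ioi 1) := by
  intro q hq
  have hq : (1 : ℝ) < q := hq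
  have hc : Filter.Tendsto (fun r : ℝ => |(M : ℝ) / (q - 1) - M / (r - 1)|)
      (nhdsWithin q (Set.Ioi 1)) (nhds 0) := by
    have : ContinuousAt (fun r : ℝ => |(M : ℝ) / (q - 1) - M / (r - 1)|) q := by
      have : q - 1 ≠ 0 := by linarith
      fun_prop (disch := assumption)
    have h := this.tendsto.mono_left (nhdsWithin_le_nhds (s := Set.Ioi 1))
    simpa using h
  rw [ContinuousWithinAt, tendsto_iff_dist_tendsto_zero]
  refine squeeze_zero' (Filter.Eventually.of_forall fun _ => dist_nonneg) ?_ hc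
  filter_upwards [self_mem_nhdsWithin] with r hr
  have hr : (1 : ℝ) < r := hr
  rw [Real.dist_eq]
  rcases le_total q r with h | h
  · have h1 := piQ_anti hq h d
    have h2 := piQ_sub_le hq h d
    rw [abs_sub_comm, abs_of_nonneg (by linarith)]
    exact h2.trans (le_abs_self _)
  · have h1 := piQ_anti hr h d
    have h2 := piQ_sub_le hr h d
    rw [abs_of_nonneg (by linarith), abs_sub_comm]
    exact h2.trans (le_abs_self _)

lemma continuous_piQ {q : ℝ} (hq : 1 < q) : Continuous (piQ M q) := by
  refine continuous_tsum (u := fun i : ℕ => (M : ℝ) * (1 / q) ^ (i + 1)) (fun i => ?_) ?_ ?_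
  · exact (continuous_of_discreteTopology (f := fun a : Fin (M + 1) => (a : ℝ) / q ^ (i + 1))).comp
      (continuous_apply i)
  · exact ((summable_nat_add_iff 1).2
      (summable_geometric_of_lt_one (by positivity) (by rw [div_lt_one] <;> linarith))).mul_left _
  · intro i d
    rw [Real.norm_of_nonneg (by positivity), one_div, inv_pow, ← div_eq_mul_inv]
    gcongr
    exact_mod_cast Nat.lt_succ_iff.1 (d i).is_lt

/-- A digit sequence driven by bounded remainders expands the initial remainder. -/
lemma piQ_eq_of_remainder {q B : ℝ} (hq : 1 < q) (d : Digits M) (r : ℕ → ℝ)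
    (hr : ∀ n, r (n + 1) = q * r n - d n) (hB : ∀ n, |r n| ≤ B) : piQ M q d = r 0 := by
  have h0 : q ≠ 0 := by positivity
  have key : ∀ n, q ^ n * (piQ M q d - r 0) = piQ M q (shift n d) - r n := by
    intro n
    induction n with
    | zero => simp
    | succ n ih =>
      have h2 := piQ_cons hq (shift n d)
      rw [shift_shift, add_comm 1 n] at h2
      simp only [shift_apply, zero_add] at h2
      rw [hr, pow_succ]
      linear_combination q * ih + h2
  by_contra hne
  have hpos : 0 < |piQ M q d - r 0| := abs_pos.2 (sub_ne_zero.2 hne)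
  obtain ⟨n, hn⟩ := pow_unbounded_of_one_lt ((M / (q - 1) + B) / |piQ M q d - r 0|) hq
  rw [div_lt_iff₀ hpos] at hn
  have h1 : |q ^ n * (piQ M q d - r 0)| ≤ M / (q - 1) + B := by
    rw [key]
    refine (abs_sub _ _).trans (add_le_add ?_ (hB n))
    rw [abs_of_nonneg (piQ_nonneg hq _)]; exact piQ_le hq _
  rw [abs_mul, abs_of_pos (by positivity)] at h1
  linarith

lemma exists_expansion {q y : ℝ} (hq : 1 < q) (hqM : q ≤ M + 1) (hy : y ∈ Set.Icc 0 (M / (q - 1))) :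
    ∃ d : Digits M, piQ M q d = y := by
  have hq1 : 0 < q - 1 := by linarith
  have h1 : 1 ≤ (M : ℝ) / (q - 1) := by rw [le_div_iff₀ hq1]; linarith
  have step : ∀ r : ℝ, ∃ a : Fin (M + 1), r ∈ Set.Icc (0 : ℝ) (M / (q - 1)) →
      q * r - a ∈ Set.Icc (0 : ℝ) (M / (q - 1)) := by
    intro r
    by_cases hr : r ∈ Set.Icc (0 : ℝ) (M / (q - 1))
    · have hqr : 0 ≤ q * r := mul_nonneg (by linarith) hr.1
      by_cases hf : ⌊q * r⌋₊ ≤ M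
      · refine ⟨⟨⌊q * r⌋₊, by omega⟩, fun _ => ⟨?_, ?_⟩⟩
        · simpa using Nat.floor_le hqr
        · have := Nat.lt_floor_add_one (q * r)
          simp only; linarith
      · refine ⟨Fin.last M, fun _ => ⟨?_, ?_⟩⟩
        · have := Nat.floor_le hqr
          have h2 : (M : ℝ) ≤ ⌊q * r⌋₊ := by exact_mod_cast (not_le.1 hf).le
          simp only [Fin.val_last]; linarith
        · have h3 := hr.2
          rw [le_div_iff₀ hq1] at h3 ⊢
          simp only [Fin.val_last]
          nlinarith
    · exact ⟨0, fun h => absurd h hr⟩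
  choose a ha using step
  let r : ℕ → ℝ := fun n => n.rec y fun _ r => q * r - a r
  have hmem : ∀ n, r n ∈ Set.Icc (0 : ℝ) (M / (q - 1)) := by
    intro n
    induction n with
    | zero => exact hy
    | succ n ih => exact ha _ ih
  refine ⟨fun n => a (r n), piQ_eq_of_remainder hq _ r (fun n => rfl) (B := M / (q - 1)) fun n => ?_⟩
  rw [abs_of_nonneg (hmem n).1]; exact (hmem n).2

/-! ### Quasi-greedy expansions of `1` -/

/-- `b` is the expansion of `1` in base `q` all of whose tails have value in `(0, 1]`. -/
structure IsQG (q : ℝ) (b : Digits M) : Prop where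
  piQ_eq : piQ M q b = 1
  pos : ∀ n, 0 < piQ M q (shift n b)
  le_one : ∀ n, piQ M q (shift n b) ≤ 1

lemma exists_isQG {q : ℝ} (hq : 1 < q) (hqM : q ≤ M + 1) : ∃ b : Digits M, IsQG q b := by
  have step : ∀ r : ℝ, ∃ a : Fin (M + 1), r ∈ Set.Ioc (0 : ℝ) 1 →
      q * r - a ∈ Set.Ioc (0 : ℝ) 1 := by
    intro r
    by_cases hr : r ∈ Set.Ioc (0 : ℝ) 1
    · have hqr : 0 < q * r := mul_pos (by linarith) hr.1
      have h1 : 1 ≤ ⌈q * r⌉₊ := Nat.one_le_ceil_iff.2 hqr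
      have h2 : ⌈q * r⌉₊ ≤ M + 1 := by
        refine Nat.ceil_le.2 ?_
        push_cast
        nlinarith [hr.2]
      have h3 := Nat.ceil_lt_add_one hqr.le
      have h4 := Nat.le_ceil (q * r)
      refine ⟨⟨⌈q * r⌉₊ - 1, by omega⟩, fun _ => ?_⟩
      simp only [Set.mem_Ioc]
      rw [Nat.cast_sub h1]
      push_cast
      constructor <;> linarith
    · exact ⟨0, fun h => absurd h hr⟩
  choose a ha using step
  let r : ℕ → ℝ := fun n => n.rec 1 fun _ r => q * r - a r
  have hmem : ∀ n, r n ∈ Set.Ioc (0 : ℝ) 1 := by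
    intro n
    induction n with
    | zero => exact ⟨one_pos, le_rfl⟩
    | succ n ih => exact ha _ ih
  have key : ∀ n, piQ M q (shift n fun n => a (r n)) = r n := by
    intro n
    refine (piQ_eq_of_remainder hq (shift n fun n => a (r n)) (fun k => r (k + n)) (fun k => ?_)
      (B := 1) fun k => ?_).trans (by simp)
    · simp only [shift_apply]
      rw [show k + 1 + n = (k + n) + 1 by ring]
    · rw [abs_of_pos (hmem _).1]; exact (hmem _).2
  exact ⟨fun n => a (r n), key 0, fun n => (key n) ▸ (hmem n).1, fun n => (key n) ▸ (hmem n).2⟩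

lemma IsQG.one_le_of_lexLt {q : ℝ} (hq : 1 < q) {b e : Digits M} (hb : IsQG q b)
    (h : lexLt b e) :
    ∃ n, 1 + piQ M q (shift n e) / q ^ n ≤ piQ M q e := by
  obtain ⟨n, hn, hlt⟩ := h
  refine ⟨n + 1, ?_⟩
  have h0 : (0 : ℝ) < q ^ (n + 1) := by positivity
  have h1 := piQ_sub_piQ_of_ne hq hn
  have h2 := hb.le_one (n + 1)
  have h3 : (b n : ℝ) + 1 ≤ e n := by exact_mod_cast hlt
  rw [hb.piQ_eq] at h1
  have h4 := mul_div_cancel₀ (piQ M q (shift (n + 1) e)) h0.ne'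
  rw [← mul_le_mul_iff_right₀ h0, mul_add]
  nlinarith

lemma IsQG.lexLt_of_piQ_lt {q : ℝ} (hq : 1 < q) {b e : Digits M} (hb : IsQG q b)
    (h : piQ M q e < 1) : lexLt e b := by
  by_contra hn
  rcases not_lexLt.1 hn with rfl | h'
  · exact h.ne hb.piQ_eq
  · obtain ⟨n, hn⟩ := hb.one_le_of_lexLt hq h'
    have : 0 ≤ piQ M q (shift n e) / q ^ n := div_nonneg (piQ_nonneg hq _) (by positivity)
    linarith

lemma IsQG.shift_lexLe {q : ℝ} (hq : 1 < q) {b : Digits M} (hb : IsQG q b) (k : ℕ) :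
    lexLe (shift k b) b := by
  rw [← not_lexLt]
  intro h
  obtain ⟨n, hn⟩ := hb.one_le_of_lexLt hq h
  rw [shift_shift] at hn
  have : 0 < piQ M q (shift (n + k) b) / q ^ n := div_pos (hb.pos _) (by positivity)
  linarith [hb.le_one k]

/-! ### Unique expansions -/

/-- Value criterion for a sequence to be a unique expansion. -/
lemma mem_UqSym_of_forall {q : ℝ} (hq : 1 < q) {d : Digits M}
    (h1 : ∀ n, d n < Fin.last M → piQ M q (shift (n + 1) d) < 1)
    (h2 : ∀ n, 0 < d n → piQ M q (shift (n + 1) (mirror d)) < 1) : d ∈ UqSym M q := by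
  intro e he
  by_contra hne
  have hex : ∃ n, e n ≠ d n := by
    by_contra h; push Not at h; exact hne (funext h)
  have hn := Nat.find_spec hex
  have hlt : ∀ i < Nat.find hex, e i = d i := fun i hi => not_not.1 (Nat.find_min hex hi)
  set n := Nat.find hex
  have key := piQ_sub_piQ_of_ne hq hlt
  rw [he, sub_self, mul_zero] at key
  rcases lt_or_gt_of_ne hn with h | h
  · have a1 := h2 n (lt_of_le_of_lt (Fin.zero_le _) h)
    rw [← mirror_shift, piQ_mirror hq] at a1
    have a2 := piQ_le hq (shift (n + 1) e)
    have a3 : (e n : ℝ) + 1 ≤ d n := by exact_mod_cast h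
    linarith
  · have a1 := h1 n (lt_of_lt_of_le h (Fin.le_last _))
    have a2 := piQ_nonneg hq (shift (n + 1) e)
    have a3 : (d n : ℝ) + 1 ≤ e n := by exact_mod_cast h
    linarith

lemma piQ_shift_lt_of_mem_UqSym {q : ℝ} (hq : 1 < q) (hqM : q ≤ M + 1) {d : Digits M}
    (hd : d ∈ UqSym M q) {n : ℕ} (hn : d n < Fin.last M) : piQ M q (shift (n + 1) d) < 1 := by
  by_contra hge
  push Not at hge
  obtain ⟨f, hf⟩ := exists_expansion (y := piQ M q (shift (n + 1) d) - 1) hq hqM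
    ⟨by linarith, by linarith [piQ_le hq (shift (n + 1) d)]⟩
  let a : Fin (M + 1) := ⟨d n + 1, by have : (d n : ℕ) < M := hn; omega⟩
  let e : Digits M := fun i => if i < n then d i else if i = n then a else f (i - (n + 1))
  have e1 : ∀ i < n, e i = d i := fun i hi => by simp [e, hi]
  have e2 : e n = a := by simp [e]
  have e3 : shift (n + 1) e = f := by
    funext i
    have h1 : ¬ i + (n + 1) < n := by omega
    have h2 : ¬ i + (n + 1) = n := by omega
    simp [e, h1, h2]
  have key := piQ_sub_piQ_of_ne hq e1
  have h0 : (0 : ℝ) < q ^ (n + 1) := by positivity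
  rw [e2, e3, hf] at key
  have : piQ M q e = piQ M q d := by
    have : q ^ (n + 1) * (piQ M q e - piQ M q d) = 0 := by
      rw [key]; simp [a]
    rcases mul_eq_zero.1 this with h | h
    · exact absurd h h0.ne'
    · linarith
  have := congrFun (hd e this) n
  rw [e2] at this
  have := congrArg Fin.val this
  simp [a] at this

lemma mirror_mem_UqSym {q : ℝ} (hq : 1 < q) {d : Digits M} (hd : d ∈ UqSym M q) :
    mirror d ∈ UqSym M q := by
  intro e he
  have h := hd (mirror e) (by rw [piQ_mirror hq, he, piQ_mirror hq]; ring)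
  rw [← h, mirror_mirror]

lemma piQ_shift_mirror_lt_of_mem_UqSym {q : ℝ} (hq : 1 < q) (hqM : q ≤ M + 1) {d : Digits M}
    (hd : d ∈ UqSym M q) {n : ℕ} (hn : 0 < d n) : piQ M q (shift (n + 1) (mirror d)) < 1 := by
  refine piQ_shift_lt_of_mem_UqSym hq hqM (mirror_mem_UqSym hq hd) ?_
  rw [mirror_apply, ← Fin.rev_zero]
  exact Fin.rev_lt_rev.2 hn

lemma UqSym_mono {q q' : ℝ} (hq : 1 < q) (hqq : q ≤ q') (hqM : q ≤ M + 1) :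
    UqSym M q ⊆ UqSym M q' := fun _ hd =>
  mem_UqSym_of_forall (hq.trans_le hqq)
    (fun _ hn => (piQ_anti hq hqq _).trans_lt (piQ_shift_lt_of_mem_UqSym hq hqM hd hn))
    (fun _ hn => (piQ_anti hq hqq _).trans_lt (piQ_shift_mirror_lt_of_mem_UqSym hq hqM hd hn))

lemma piQ_mem_Uq {q : ℝ} {d : Digits M} (hd : d ∈ UqSym M q) : piQ M q d ∈ Uq M q :=
  ⟨d, rfl, fun e he => hd e he⟩

lemma exists_of_mem_Uq {q y : ℝ} (hy : y ∈ Uq M q) : ∃ d ∈ UqSym M q, piQ M q d = y := by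
  obtain ⟨d, hd, h⟩ := hy
  exact ⟨d, fun e he => h e (he.trans hd), hd⟩

/-! ### Words and the counting recursion -/

/-- The word formed by the first `n` digits. -/
def pfx : ℕ → Digits M → List (Fin (M + 1))
  | 0, _ => []
  | n + 1, d => d 0 :: pfx n (shift 1 d)

/-- The reflection of a word. -/
def revWord (w : List (Fin (M + 1))) : List (Fin (M + 1)) := w.map Fin.rev

@[simp] lemma length_pfx (n : ℕ) (d : Digits M) : (pfx n d).length = n := by
  induction n generalizing d with
  | zero => rfl
  | succ n ih => simp [pfx, ih]

lemma pfx_eq_iff {n : ℕ} {c d : Digits M} : pfx n c = pfx n d ↔ ∀ i < n, c i = d i := by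
  induction n generalizing c d with
  | zero => simp [pfx]
  | succ n ih =>
    simp only [pfx, List.cons.injEq, ih, shift_apply]
    constructor
    · rintro ⟨h0, h⟩ i hi
      cases i with
      | zero => exact h0
      | succ i => exact h i (by omega)
    · intro h
      exact ⟨h 0 (by omega), fun i hi => h (i + 1) (by omega)⟩

lemma pfx_mirror (n : ℕ) (d : Digits M) : pfx n (mirror d) = revWord (pfx n d) := by
  induction n generalizing d with
  | zero => rfl
  | succ n ih =>
    simp only [pfx, ← mirror_shift, ih]
    rfl

lemma exists_pfx_eq (w : List (Fin (M + 1))) : ∃ d : Digits M, pfx w.length d = w := by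
  induction w with
  | nil => exact ⟨fun _ => 0, rfl⟩
  | cons a w ih =>
    obtain ⟨d, hd⟩ := ih
    refine ⟨fun n => Nat.casesOn n a d, ?_⟩
    have : shift 1 (fun n => (Nat.casesOn n a d : Fin (M + 1))) = d := rfl
    simp only [List.length_cons, pfx, this, hd]
    rfl

lemma cons_le_cons_iff {a a' : Fin (M + 1)} {u u' : List (Fin (M + 1))} :
    a :: u ≤ a' :: u' ↔ a < a' ∨ a = a' ∧ u ≤ u' := by
  rw [← not_lt, List.cons_lt_cons_iff, ← not_lt (a := u')]
  push Not
  constructor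
  · rintro ⟨h1, h2⟩
    rcases h1.lt_or_eq with h | h
    · exact Or.inl h
    · exact Or.inr ⟨h, h2 h.symm⟩
  · rintro (h | ⟨rfl, h⟩)
    · exact ⟨h.le, fun e => absurd e h.ne'⟩
    · exact ⟨le_refl _, fun _ => h⟩

lemma pfx_le_of_succ {n : ℕ} {c d : Digits M} (h : pfx (n + 1) c ≤ pfx (n + 1) d) :
    pfx n c ≤ pfx n d := by
  induction n generalizing c d with
  | zero => exact le_refl _
  | succ n ih =>
    rw [pfx, pfx.eq_2 d, cons_le_cons_iff] at h
    rw [pfx, pfx, cons_le_cons_iff]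
    exact h.imp_right fun h => ⟨h.1, ih h.2⟩

lemma pfx_lt_iff {n : ℕ} {c d : Digits M} :
    pfx n c < pfx n d ↔ ∃ k < n, (∀ i < k, c i = d i) ∧ c k < d k := by
  induction n generalizing c d with
  | zero => simp [pfx]
  | succ n ih =>
    rw [pfx, pfx, List.cons_lt_cons_iff, ih]
    constructor
    · rintro (h | ⟨h0, k, hk, hn, hlt⟩)
      · exact ⟨0, by omega, by simp, h⟩
      · refine ⟨k + 1, by omega, fun i hi => ?_, hlt⟩
        cases i with
        | zero => exact h0
        | succ i => exact hn i (by omega)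
    · rintro ⟨k, hk, hn, hlt⟩
      cases k with
      | zero => exact Or.inl hlt
      | succ k =>
        exact Or.inr ⟨hn 0 (by omega), k, by omega, fun i hi => hn (i + 1) (by omega), hlt⟩

lemma lexLe_iff_pfx {c d : Digits M} : lexLe c d ↔ ∀ n, pfx n c ≤ pfx n d := by
  rw [← not_lexLt, ← not_iff_not]
  push Not
  constructor
  · rintro ⟨n, h⟩
    exact ⟨n + 1, pfx_lt_iff.2 ⟨n, by omega, h⟩⟩
  · rintro ⟨n, h⟩
    obtain ⟨k, -, h⟩ := pfx_lt_iff.1 h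
    exact ⟨k, h⟩

lemma revWord_revWord (w : List (Fin (M + 1))) : revWord (revWord w) = w := by
  simp [revWord, Function.comp_def]

lemma revWord_lt {w w' : List (Fin (M + 1))} (h : w.length = w'.length) :
    revWord w < revWord w' ↔ w' < w := by
  obtain ⟨d, hd⟩ := exists_pfx_eq w
  obtain ⟨d', hd'⟩ := exists_pfx_eq w'
  rw [← h] at hd'
  rw [← hd, ← hd', ← pfx_mirror, ← pfx_mirror, pfx_lt_iff, pfx_lt_iff]
  simp only [mirror_apply, Fin.rev_inj, Fin.rev_lt_rev]
  exact exists_congr fun n => and_congr_right' (and_congr_left' (forall₂_congr fun i _ => eq_comm))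

lemma revWord_le {w w' : List (Fin (M + 1))} (h : w.length = w'.length) :
    revWord w ≤ revWord w' ↔ w' ≤ w := by
  rw [← not_lt, ← not_lt, revWord_lt h.symm]

/-- All one-letter extensions to the left of a finite set of words. -/
def ext (A : Finset (List (Fin (M + 1)))) : Finset (List (Fin (M + 1))) :=
  (Finset.univ ×ˢ A).image fun p => p.1 :: p.2

/-- Words of length `n` all of whose suffixes lie between the prefixes of `mirror γ` and `γ`. -/
def words (γ : Digits M) : ℕ → Finset (List (Fin (M + 1)))
  | 0 => {[]}
  | n + 1 => (ext (words γ n)).filter fun w => w ≤ pfx (n + 1) γ ∧ pfx (n + 1) (mirror γ) ≤ w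

/-- Sequences all of whose tails lie between `mirror γ` and `γ`. -/
def V (γ : Digits M) : Set (Digits M) :=
  {d | ∀ n, lexLe (shift n d) γ ∧ lexLe (mirror γ) (shift n d)}

lemma mem_ext {A : Finset (List (Fin (M + 1)))} {w : List (Fin (M + 1))} :
    w ∈ ext A ↔ ∃ a, ∃ u ∈ A, a :: u = w := by
  simp [ext]

lemma cons_mem_ext {A : Finset (List (Fin (M + 1)))} {a : Fin (M + 1)} {w : List (Fin (M + 1))} :
    a :: w ∈ ext A ↔ w ∈ A := by
  simp [ext]

lemma cons_injective :
    Function.Injective fun p : Fin (M + 1) × List (Fin (M + 1)) => p.1 :: p.2 := by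
  rintro ⟨a, u⟩ ⟨a', u'⟩ h
  simpa using h

lemma card_ext (A : Finset (List (Fin (M + 1)))) : (ext A).card = (M + 1) * A.card := by
  rw [ext, Finset.card_image_of_injective _ cons_injective]
  simp

lemma length_of_mem_words {γ : Digits M} {n : ℕ} {w : List (Fin (M + 1))} (h : w ∈ words γ n) :
    w.length = n := by
  induction n generalizing w with
  | zero => simp [words] at h; simp [h]
  | succ n ih =>
    rw [words, Finset.mem_filter, mem_ext] at h
    obtain ⟨⟨a, u, hu, rfl⟩, -⟩ := h
    simp [ih hu]

lemma pfx_succ_mem_words {γ d : Digits M} {n : ℕ} :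
    pfx (n + 1) d ∈ words γ (n + 1) ↔ pfx n (shift 1 d) ∈ words γ n ∧
      pfx (n + 1) d ≤ pfx (n + 1) γ ∧ pfx (n + 1) (mirror γ) ≤ pfx (n + 1) d := by
  rw [words, Finset.mem_filter]
  rw [pfx, cons_mem_ext]

lemma exists_of_mem_words {γ : Digits M} {n : ℕ} {w : List (Fin (M + 1))} (h : w ∈ words γ n) :
    ∃ d, pfx n d = w := by
  obtain ⟨d, hd⟩ := exists_pfx_eq w
  rw [length_of_mem_words h] at hd
  exact ⟨d, hd⟩

lemma pfx_mem_words_of_succ {γ d : Digits M} {n : ℕ} (h : pfx (n + 1) d ∈ words γ (n + 1)) :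
    pfx n d ∈ words γ n := by
  induction n generalizing d with
  | zero => simp [words, pfx]
  | succ n ih =>
    rw [pfx_succ_mem_words] at h ⊢
    exact ⟨ih h.1, pfx_le_of_succ h.2.1, pfx_le_of_succ h.2.2⟩

lemma pfx_mem_words_of_le {γ d : Digits M} {m n : ℕ} (hmn : m ≤ n) (h : pfx n d ∈ words γ n) :
    pfx m d ∈ words γ m := by
  induction n, hmn using Nat.le_induction with
  | base => exact h
  | succ n _ ih => exact ih (pfx_mem_words_of_succ h)

lemma pfx_shift_mem_words {γ d : Digits M} {m n : ℕ} (h : pfx (n + m) d ∈ words γ (n + m)) :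
    pfx n (shift m d) ∈ words γ n := by
  induction m generalizing d with
  | zero => exact h
  | succ m ih =>
    rw [← add_assoc, pfx_succ_mem_words] at h
    rw [← shift_shift]
    exact ih h.1

lemma mem_V_iff {γ d : Digits M} : d ∈ V γ ↔ ∀ n, pfx n d ∈ words γ n := by
  constructor
  · intro h n
    induction n generalizing d with
    | zero => simp [words, pfx]
    | succ n ih =>
      rw [pfx_succ_mem_words]
      refine ⟨ih fun k => ?_, lexLe_iff_pfx.1 (h 0).1 _, lexLe_iff_pfx.1 (h 0).2 _⟩
      rw [shift_shift]; exact h _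
  · intro h n
    have key : ∀ m, pfx (m + 1) (shift n d) ∈ words γ (m + 1) := fun m => pfx_shift_mem_words (h _)
    simp only [pfx_succ_mem_words] at key
    rw [lexLe_iff_pfx, lexLe_iff_pfx]
    exact ⟨fun m => pfx_le_of_succ (key m).2.1, fun m => pfx_le_of_succ (key m).2.2⟩

lemma words_congr {γ γ' : Digits M} {n : ℕ} (h : ∀ i < n, γ i = γ' i) : words γ n = words γ' n := by
  induction n with
  | zero => rfl
  | succ n ih =>
    rw [words, words, ih fun i hi => h i (by omega), pfx_eq_iff.2 h, pfx_mirror, pfx_mirror,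
      pfx_eq_iff.2 h]

lemma revWord_mem_ext {A : Finset (List (Fin (M + 1)))} (hA : ∀ w ∈ A, revWord w ∈ A)
    {w : List (Fin (M + 1))} (h : w ∈ ext A) : revWord w ∈ ext A := by
  obtain ⟨a, u, hu, rfl⟩ := mem_ext.1 h
  exact cons_mem_ext.2 (hA u hu)

lemma length_of_mem_ext_words {γ : Digits M} {n : ℕ} {w : List (Fin (M + 1))}
    (h : w ∈ ext (words γ n)) : w.length = n + 1 := by
  obtain ⟨a, u, hu, rfl⟩ := mem_ext.1 h
  simp [length_of_mem_words hu]

lemma revWord_mem_words {γ : Digits M} {n : ℕ} : ∀ w ∈ words γ n, revWord w ∈ words γ n := by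
  induction n with
  | zero => simp [words, revWord]
  | succ n ih =>
    intro w hw
    rw [words, Finset.mem_filter] at hw ⊢
    have hl := length_of_mem_ext_words hw.1
    refine ⟨revWord_mem_ext ih hw.1, ?_, ?_⟩
    · rw [← revWord_revWord (pfx (n + 1) γ), ← pfx_mirror, revWord_le (by simp [hl])]
      exact hw.2.2
    · rw [pfx_mirror, revWord_le (by simp [hl])]
      exact hw.2.1

/-- The number of admissible words of length `n`. -/
def numWords (γ : Digits M) (n : ℕ) : ℝ := (words γ n).card

/-- Twice the number of admissible words up to `c`, minus the number of admissible words. -/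
def height (γ c : Digits M) (n : ℕ) : ℝ :=
  2 * ((words γ n).filter (· ≤ pfx n c)).card - numWords γ n

lemma card_filter_ext_le (γ c : Digits M) (n : ℕ) :
    ((ext (words γ n)).filter (· ≤ pfx (n + 1) c)).card =
      (c 0 : ℕ) * (words γ n).card + ((words γ n).filter (· ≤ pfx n (shift 1 c))).card := by
  have e : (ext (words γ n)).filter (· ≤ pfx (n + 1) c) =
      ((Finset.Iio (c 0) ×ˢ words γ n) ∪
        ({c 0} ×ˢ (words γ n).filter (· ≤ pfx n (shift 1 c)))).image fun p => p.1 :: p.2 := by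
    ext w
    rw [Finset.mem_filter, mem_ext]
    simp only [Finset.mem_image, Finset.mem_union, Finset.mem_product, Finset.mem_Iio,
      Finset.mem_singleton, Finset.mem_filter, Prod.exists]
    constructor
    · rintro ⟨⟨a, u, hu, rfl⟩, hle⟩
      rw [pfx, cons_le_cons_iff] at hle
      exact ⟨a, u, hle.imp (fun h => ⟨h, hu⟩) (fun h => ⟨h.1, hu, h.2⟩), rfl⟩
    · rintro ⟨a, u, h | h, rfl⟩
      · exact ⟨⟨a, u, h.2, rfl⟩, by rw [pfx, cons_le_cons_iff]; exact Or.inl h.1⟩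
      · exact ⟨⟨a, u, h.2.1, rfl⟩, by rw [pfx, cons_le_cons_iff]; exact Or.inr ⟨h.1, h.2.2⟩⟩
  rw [e, Finset.card_image_of_injective _ cons_injective, Finset.card_union_of_disjoint]
  · simp
  · rw [Finset.disjoint_left]
    rintro ⟨a, u⟩ h1 h2
    simp only [Finset.mem_product, Finset.mem_Iio, Finset.mem_singleton] at h1 h2
    exact h1.1.ne h2.1

lemma card_filter_ext_lt_mirror (γ : Digits M) (n : ℕ) :
    ((ext (words γ n)).filter (· < pfx (n + 1) (mirror γ))).card =
      ((ext (words γ n)).filter (pfx (n + 1) γ < ·)).card := by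
  refine Finset.card_nbij' revWord revWord ?_ ?_ (fun w _ => revWord_revWord w)
    (fun w _ => revWord_revWord w)
  · intro w hw
    simp only [Finset.coe_filter, Set.mem_ofPred_eq] at hw ⊢
    have hl := length_of_mem_ext_words hw.1
    refine ⟨revWord_mem_ext revWord_mem_words hw.1, ?_⟩
    rw [← revWord_revWord (pfx (n + 1) γ), ← pfx_mirror, revWord_lt (by simp [hl])]
    exact hw.2
  · intro w hw
    simp only [Finset.coe_filter, Set.mem_ofPred_eq] at hw ⊢
    have hl := length_of_mem_ext_words hw.1
    refine ⟨revWord_mem_ext revWord_mem_words hw.1, ?_⟩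
    rw [pfx_mirror, revWord_lt (by simp [hl])]
    exact hw.2

lemma card_filter_words_succ {γ c : Digits M} (n : ℕ) (h1 : lexLe c γ) (h2 : lexLe (mirror γ) c) :
    ((words γ (n + 1)).filter (· ≤ pfx (n + 1) c)).card + (M + 1) * (words γ n).card =
      ((ext (words γ n)).filter (· ≤ pfx (n + 1) c)).card +
      ((ext (words γ n)).filter (· ≤ pfx (n + 1) γ)).card := by
  have h1 := lexLe_iff_pfx.1 h1 (n + 1)
  have h2 := lexLe_iff_pfx.1 h2 (n + 1)
  have e1 : ((ext (words γ n)).filter (· ≤ pfx (n + 1) γ)).card +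
      ((ext (words γ n)).filter (pfx (n + 1) γ < ·)).card = (M + 1) * (words γ n).card := by
    rw [← card_ext, ← Finset.card_filter_add_card_filter_not (s := ext (words γ n))
      (· ≤ pfx (n + 1) γ)]
    simp only [not_le]
  have e2 : ((words γ (n + 1)).filter (· ≤ pfx (n + 1) c)).card +
      ((ext (words γ n)).filter (· < pfx (n + 1) (mirror γ))).card =
      ((ext (words γ n)).filter (· ≤ pfx (n + 1) c)).card := by
    rw [← Finset.card_union_of_disjoint]
    · congr 1
      ext w
      simp only [words, Finset.mem_union, Finset.mem_filter]
      constructor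
      · rintro (⟨⟨hw, -⟩, hc⟩ | ⟨hw, hlt⟩)
        · exact ⟨hw, hc⟩
        · exact ⟨hw, hlt.le.trans h2⟩
      · rintro ⟨hw, hc⟩
        rcases lt_or_ge w (pfx (n + 1) (mirror γ)) with h | h
        · exact Or.inr ⟨hw, h⟩
        · exact Or.inl ⟨⟨hw, hc.trans h1, h⟩, hc⟩
    · rw [Finset.disjoint_left]
      intro w ha hb
      simp only [words, Finset.mem_filter] at ha hb
      exact absurd hb.2 (not_lt.2 ha.1.2.2)
  rw [card_filter_ext_lt_mirror] at e2
  omega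

lemma height_self (γ : Digits M) (n : ℕ) : height γ γ n = numWords γ n := by
  have : (words γ n).filter (· ≤ pfx n γ) = words γ n := by
    rw [Finset.filter_eq_self]
    intro w hw
    cases n with
    | zero => simp only [words, Finset.mem_singleton] at hw; rw [hw, pfx]
    | succ n => exact (Finset.mem_filter.1 hw).2.1
  rw [height, this, numWords]; ring

lemma height_succ {γ c : Digits M} (n : ℕ) (h1 : lexLe c γ) (h2 : lexLe (mirror γ) c) :
    height γ c (n + 1) = height γ (shift 1 c) n + (2 * (c 0 : ℝ) - M) * numWords γ n := by
  have a1 := card_filter_words_succ n h1 h2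
  have a2 := card_filter_words_succ n (lexLe_refl γ) (h2.trans h1)
  have a3 := card_filter_ext_le γ c n
  have b := height_self γ (n + 1)
  simp only [height, numWords] at b ⊢
  have a1' := congrArg (Nat.cast (R := ℝ)) a1
  have a2' := congrArg (Nat.cast (R := ℝ)) a2
  have a3' := congrArg (Nat.cast (R := ℝ)) a3
  push_cast at a1' a2' a3'
  linarith

lemma height_zero (γ c : Digits M) : height γ c 0 = 1 := by
  have : height γ c 0 = height γ γ 0 := rfl
  rw [this, height_self]
  simp [numWords, words]

lemma abs_height_le (γ c : Digits M) (n : ℕ) : |height γ c n| ≤ numWords γ n := by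
  have h : ((words γ n).filter (· ≤ pfx n c)).card ≤ (words γ n).card := Finset.card_filter_le _ _
  have h' : (((words γ n).filter (· ≤ pfx n c)).card : ℝ) ≤ (words γ n).card := by exact_mod_cast h
  rw [height, numWords, abs_le]
  constructor <;> nlinarith [((words γ n).filter (· ≤ pfx n c)).card.cast_nonneg (α := ℝ)]

lemma height_le_of_le_mirror {γ c : Digits M} (h : lexLe c (mirror γ)) (n : ℕ) :
    height γ c n ≤ 2 - numWords γ n := by
  have h := lexLe_iff_pfx.1 h n
  have : ((words γ n).filter (· ≤ pfx n c)).card ≤ 1 := by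
    rw [Finset.card_le_one]
    have key : ∀ w ∈ (words γ n).filter (· ≤ pfx n c), w = pfx n (mirror γ) := by
      intro w hw
      rw [Finset.mem_filter] at hw
      cases n with
      | zero => simpa [words, pfx] using hw.1
      | succ n => exact le_antisymm (hw.2.trans h) (Finset.mem_filter.1 hw.1).2.2
    intro w hw w' hw'
    rw [key w hw, key w' hw']
  have h' : (((words γ n).filter (· ≤ pfx n c)).card : ℝ) ≤ 1 := by exact_mod_cast this
  rw [height]; linarith

lemma numWords_nonneg (γ : Digits M) (n : ℕ) : 0 ≤ numWords γ n := Nat.cast_nonneg _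

/-! ### Generating functions -/

/-- The generating function of the numbers of admissible words. -/
noncomputable def wordSum (γ : Digits M) (r : ℝ) : ℝ := ∑' n, numWords γ n * r ^ n

/-- The generating function of the heights. -/
noncomputable def heightSum (γ c : Digits M) (r : ℝ) : ℝ := ∑' n, height γ c n * r ^ n

lemma heightSum_self (γ : Digits M) (r : ℝ) : heightSum γ γ r = wordSum γ r := by
  simp only [heightSum, wordSum, height_self]

lemma summable_height {γ : Digits M} {r : ℝ} (hr : 0 ≤ r)
    (hs : Summable fun n => numWords γ n * r ^ n) (c : Digits M) :
    Summable fun n => height γ c n * r ^ n := by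
  refine Summable.of_norm_bounded hs fun n => ?_
  rw [Real.norm_eq_abs, abs_mul, abs_of_nonneg (pow_nonneg hr n)]
  exact mul_le_mul_of_nonneg_right (abs_height_le γ c n) (by positivity)

lemma abs_heightSum_le {γ : Digits M} {r : ℝ} (hr : 0 ≤ r)
    (hs : Summable fun n => numWords γ n * r ^ n) (c : Digits M) :
    |heightSum γ c r| ≤ wordSum γ r := by
  rw [← Real.norm_eq_abs]
  refine tsum_of_norm_bounded hs.hasSum fun n => ?_
  rw [Real.norm_eq_abs, abs_mul, abs_of_nonneg (pow_nonneg hr n)]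
  exact mul_le_mul_of_nonneg_right (abs_height_le γ c n) (by positivity)

lemma heightSum_succ {γ c : Digits M} {r : ℝ} (hr : 0 ≤ r)
    (hs : Summable fun n => numWords γ n * r ^ n) (h1 : lexLe c γ) (h2 : lexLe (mirror γ) c) :
    heightSum γ c r =
      1 + r * heightSum γ (shift 1 c) r + (2 * (c 0 : ℝ) - M) * r * wordSum γ r := by
  rw [heightSum, (summable_height hr hs c).tsum_eq_zero_add, height_zero]
  simp only [height_succ _ h1 h2]
  rw [heightSum, wordSum, ← tsum_mul_left, ← tsum_mul_left, add_assoc,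
    ← ((summable_height hr hs _).mul_left r).tsum_add (hs.mul_left _)]
  simp only [pow_zero, mul_one]
  congr 2
  funext n
  ring

lemma heightSum_iterate {γ c : Digits M} {r : ℝ} (hr : 0 ≤ r)
    (hs : Summable fun n => numWords γ n * r ^ n) (m : ℕ)
    (h : ∀ j < m, lexLe (shift j c) γ ∧ lexLe (mirror γ) (shift j c)) :
    heightSum γ c r = ∑ j ∈ Finset.range m, r ^ j + r ^ m * heightSum γ (shift m c) r +
      (∑ j ∈ Finset.range m, (2 * (c j : ℝ) - M) * r ^ (j + 1)) * wordSum γ r := by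
  induction m with
  | zero => simp
  | succ m ih =>
    rw [ih fun j hj => h j (by omega), heightSum_succ hr hs (h m (by omega)).1 (h m (by omega)).2,
      shift_shift, add_comm 1 m, Finset.sum_range_succ, Finset.sum_range_succ]
    simp only [shift_apply, zero_add]
    ring

lemma heightSum_add_wordSum_le {γ c : Digits M} {r : ℝ} (hr : 0 ≤ r) (hr1 : r < 1)
    (hs : Summable fun n => numWords γ n * r ^ n) (h : lexLe c (mirror γ)) :
    heightSum γ c r + wordSum γ r ≤ 2 * (1 - r)⁻¹ := by
  rw [heightSum, wordSum, ← (summable_height hr hs c).tsum_add hs,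
    ← tsum_geometric_of_lt_one hr hr1, ← tsum_mul_left]
  refine Summable.tsum_le_tsum (fun n => ?_) ((summable_height hr hs c).add hs)
    ((summable_geometric_of_lt_one hr hr1).mul_left _)
  rw [← add_mul]
  exact mul_le_mul_of_nonneg_right (by linarith [height_le_of_le_mirror h n]) (by positivity)

lemma sum_pow_le {r : ℝ} (hr : 0 ≤ r) (hr1 : r < 1) (m : ℕ) :
    ∑ j ∈ Finset.range m, r ^ j ≤ (1 - r)⁻¹ := by
  rw [← tsum_geometric_of_lt_one hr hr1]
  exact (summable_geometric_of_lt_one hr hr1).sum_le_tsum _ fun i _ => by positivity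

/-- Lower the `k`-th digit by one and replace all later digits by zero. -/
def cut (b : Digits M) (k : ℕ) : Digits M := fun i =>
  if i < k then b i else if i = k then ⟨(b k : ℕ) - 1, by omega⟩ else 0

lemma cut_of_lt (b : Digits M) {k i : ℕ} (h : i < k) : cut b k i = b i := if_pos h

lemma cut_self_lt {b : Digits M} {k : ℕ} (h : 0 < b k) : cut b k k < b k := by
  have h : 0 < (b k : ℕ) := h
  rw [Fin.lt_def, cut, if_neg (lt_irrefl k), if_pos rfl]
  simp only
  omega

lemma shift_cut_lt {b : Digits M} {k j : ℕ} (h : 0 < b k) (hj : j ≤ k) :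
    lexLt (shift j (cut b k)) (shift j b) := by
  refine ⟨k - j, fun i hi => cut_of_lt b (by omega), ?_⟩
  simp only [shift_apply, Nat.sub_add_cancel hj]
  exact cut_self_lt h

lemma shift_cut_le_cut {b : Digits M} {k j : ℕ} (hb : ∀ j, lexLe (shift j b) b) (h : 0 < b k)
    (hj : j ≤ k) : lexLe (shift j (cut b k)) (cut b k) := by
  rcases Nat.eq_zero_or_pos j with rfl | hj0
  · exact lexLe_refl _
  have big : ∀ n, (∀ i < n, b (i + j) = b i) → k - j < n ∨ k - j = n ∧ b (n + j) ≤ b n →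
      lexLe (shift j (cut b k)) (cut b k) := by
    intro n hn hk
    refine lexLt.le ⟨k - j, fun i hi => ?_, ?_⟩
    · rw [shift_apply, cut_of_lt b (by omega), cut_of_lt b (by omega)]
      exact hn i (by omega)
    · rw [shift_apply, Nat.sub_add_cancel hj, cut_of_lt b (by omega : k - j < k)]
      refine (cut_self_lt h).trans_le ?_
      rcases hk with hk | ⟨rfl, hk⟩
      · rw [← hn _ hk, Nat.sub_add_cancel hj]
      · rwa [Nat.sub_add_cancel hj] at hk
  rcases hb j with e | ⟨n, hn, hlt⟩
  · exact big (k - j + 1) (fun i _ => congrFun e i) (Or.inl (by omega))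
  · rcases lt_trichotomy n (k - j) with hnk | hnk | hnk
    · refine lexLt.le ⟨n, fun i hi => ?_, ?_⟩
      · rw [shift_apply, cut_of_lt b (by omega), cut_of_lt b (by omega)]
        exact hn i hi
      · rw [shift_apply, cut_of_lt b (by omega), cut_of_lt b (by omega)]
        exact hlt
    · exact big n hn (Or.inr ⟨hnk.symm, hlt.le⟩)
    · exact big n hn (Or.inl hnk)

lemma mirror_cut_lt {b : Digits M} {j : ℕ} (h : lexLt (mirror b) (shift j b)) :
    ∃ k₀, ∀ k ≥ k₀, lexLt (mirror (cut b k)) (shift j (cut b k)) := by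
  obtain ⟨n, hn, hlt⟩ := h
  refine ⟨n + j + 1, fun k hk => ⟨n, fun i hi => ?_, ?_⟩⟩
  · have := hn i hi
    simp only [mirror_apply, shift_apply] at this ⊢
    rw [cut_of_lt b (by omega), cut_of_lt b (by omega), this]
  · simp only [mirror_apply, shift_apply] at hlt ⊢
    rw [cut_of_lt b (by omega), cut_of_lt b (by omega)]
    exact hlt

lemma mirror_cut_lt_uniform {b : Digits M} {m : ℕ} (h : ∀ j < m, lexLt (mirror b) (shift j b)) :
    ∃ k₀, ∀ k ≥ k₀, ∀ j < m, lexLt (mirror (cut b k)) (shift j (cut b k)) := by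
  induction m with
  | zero => exact ⟨0, by simp⟩
  | succ m ih =>
    obtain ⟨k₁, h₁⟩ := ih fun j hj => h j (by omega)
    obtain ⟨k₂, h₂⟩ := mirror_cut_lt (h m (by omega))
    refine ⟨max k₁ k₂, fun k hk j hj => ?_⟩
    rcases Nat.lt_succ_iff_lt_or_eq.1 hj with hj | rfl
    · exact h₁ k (le_of_max_le_left hk) j hj
    · exact h₂ k (le_of_max_le_right hk)

lemma exists_ne_zero_of_analytic {f : ℝ → ℝ} (hf : AnalyticOnNhd ℝ f (Set.Ioo (-1) 1))
    (h0 : f 0 ≠ 0) {r ρ : ℝ} (hr : 0 < r) (hrρ : r < ρ) (hρ : ρ < 1) :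
    ∃ t ∈ Set.Ioo r ρ, f t ≠ 0 := by
  by_contra hcon
  push Not at hcon
  have hmem : (r + ρ) / 2 ∈ Set.Ioo (-1 : ℝ) 1 := ⟨by linarith, by linarith⟩
  have hev : f =ᶠ[nhds ((r + ρ) / 2)] 0 := by
    filter_upwards [Ioo_mem_nhds (by linarith : r < (r + ρ) / 2) (by linarith : (r + ρ) / 2 < ρ)]
      with t ht using hcon t ht
  exact h0 (hf.eqOn_zero_of_preconnected_of_eventuallyEq_zero isPreconnected_Ioo hmem hev
    ⟨by norm_num, by norm_num⟩)

lemma analyticOnNhd_tsum {c : ℕ → ℝ} {C : ℝ} (hc : ∀ n, |c n| ≤ C) :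
    AnalyticOnNhd ℝ (fun t => ∑' n, c n * t ^ n) (Set.Ioo (-1) 1) := by
  set p := FormalMultilinearSeries.ofScalars ℝ c with hp
  have hrad : 1 ≤ p.radius := by
    refine p.le_radius_of_bound (r := 1) C fun n => ?_
    rw [hp, FormalMultilinearSeries.ofScalars_norm]
    simpa using hc n
  have hsum : p.sum = fun t => ∑' n, c n * t ^ n := by
    funext t
    exact FormalMultilinearSeries.ofScalars_sum_eq c t
  have h := (p.hasFPowerSeriesOnBall (lt_of_lt_of_le one_pos hrad)).analyticOnNhd
  rw [hsum] at h
  refine h.mono fun t ht => ?_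
  rw [Metric.mem_eball, edist_zero_right]
  refine lt_of_lt_of_le ?_ hrad
  rw [← ofReal_norm, ENNReal.ofReal_lt_one, Real.norm_eq_abs, abs_lt]
  exact ht

lemma numWords_mul_pow_le {γ : Digits M} {r : ℝ} (hr : 0 ≤ r)
    (hs : Summable fun n => numWords γ n * r ^ n) (n : ℕ) :
    numWords γ n * r ^ n ≤ wordSum γ r :=
  hs.le_tsum n fun i _ => mul_nonneg (numWords_nonneg γ i) (pow_nonneg hr i)

lemma abs_two_mul_digit_sub_le (b : Digits M) (j : ℕ) : |2 * (b j : ℝ) - M| ≤ M := by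
  have : (b j : ℝ) ≤ M := by exact_mod_cast Nat.lt_succ_iff.1 (b j).is_lt
  rw [abs_le]
  constructor <;> linarith [(b j : ℕ).cast_nonneg (α := ℝ)]

lemma sum_cut_eq {b : Digits M} {k m : ℕ} (hm : m ≤ k) (t : ℝ) :
    ∑ j ∈ Finset.range m, (2 * (cut b k j : ℝ) - M) * t ^ (j + 1) =
      ∑ j ∈ Finset.range m, (2 * (b j : ℝ) - M) * t ^ (j + 1) := by
  refine Finset.sum_congr rfl fun j hj => ?_
  rw [cut_of_lt b ((Finset.mem_range.1 hj).trans_le hm)]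

/-- Bounds on the growth of the number of admissible words pass from the truncations of a
sequence to the sequence itself. -/
lemma exists_bound_of_truncations {b : Digits M} (hb : ∀ j, lexLe (shift j b) b)
    (hb0 : lexLt (mirror b) b) (hinf : ¬ EndsInZero b) {ρ : ℝ} (hρ : ρ ≤ 1)
    (h : ∀ γ, lexLt γ b → ∀ t, 0 < t → t < ρ → Summable fun n => numWords γ n * t ^ n)
    {r : ℝ} (hr : 0 < r) (hrρ : r < ρ) :
    ∃ C, ∀ n, numWords b n * r ^ n ≤ C := by
  have hinf' : ∀ n, ∃ k ≥ n, 0 < b k := by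
    intro n
    by_contra hcon
    push Not at hcon
    exact hinf ⟨n, fun k hk => le_antisymm (hcon k hk) (Fin.zero_le _)⟩
  suffices H : ∃ t, r < t ∧ t < ρ ∧ ∃ k₀ C, ∀ k ≥ k₀, 0 < b k → wordSum (cut b k) t ≤ C by
    obtain ⟨t, hrt, htρ, k₀, C, hC⟩ := H
    refine ⟨C, fun n => ?_⟩
    obtain ⟨k, hk, hbk⟩ := hinf' (max n k₀)
    have e : numWords b n = numWords (cut b k) n := by
      rw [numWords, numWords, words_congr fun i hi => ?_]
      exact (cut_of_lt b (hi.trans_le (le_of_max_le_left hk))).symm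
    have hs := h (cut b k) (shift_cut_lt hbk (Nat.zero_le k)) t (hr.trans hrt) htρ
    calc numWords b n * r ^ n ≤ numWords (cut b k) n * t ^ n := by
          rw [e]
          exact mul_le_mul_of_nonneg_left (pow_le_pow_left₀ hr.le hrt.le n) (numWords_nonneg _ _)
      _ ≤ wordSum (cut b k) t := numWords_mul_pow_le (hr.trans hrt).le hs n
      _ ≤ C := hC k (le_of_max_le_right hk) hbk
  obtain ⟨ρ', hrρ', hρ'⟩ := exists_between hrρ
  have hρ1 : ρ' < 1 := hρ'.trans_le hρ
  by_cases hex : ∃ j, lexLe (shift j b) (mirror b)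
  · classical
    set m := Nat.find hex with hm
    have hlt : ∀ j < m, lexLt (mirror b) (shift j b) := fun j hj =>
      not_lexLe.1 (Nat.find_min hex hj)
    have hm0 : m ≠ 0 := fun e => by
      have := Nat.find_spec hex
      rw [← hm, e] at this
      exact lexLt_irrefl _ (this.trans_lt hb0)
    obtain ⟨t, ⟨hrt, htρ⟩, hD⟩ := exists_ne_zero_of_analytic
      (f := fun t => 1 - ∑ j ∈ Finset.range m, (2 * (b j : ℝ) - M) * t ^ (j + 1) + t ^ m)
      (fun t _ => by fun_prop) (by simp [hm0]) hr hrρ' hρ1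
    set P := ∑ j ∈ Finset.range m, (2 * (b j : ℝ) - M) * t ^ (j + 1) with hP
    have ht0 : 0 < t := hr.trans hrt
    have ht1 : t < 1 := htρ.trans hρ1
    obtain ⟨k₀, hk₀⟩ := mirror_cut_lt_uniform hlt
    refine ⟨t, hrt, htρ.trans hρ', max k₀ m, (3 * (1 - t)⁻¹) / |1 - P + t ^ m|,
      fun k hk hbk => ?_⟩
    have hkm : m ≤ k := le_of_max_le_right hk
    have hcb : lexLt (cut b k) b := shift_cut_lt hbk (Nat.zero_le k)
    have hs := h _ hcb t ht0 (htρ.trans hρ')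
    have h1 := heightSum_iterate ht0.le hs m (c := cut b k) fun j hj =>
      ⟨shift_cut_le_cut hb hbk (by omega), (hk₀ k (le_of_max_le_left hk) j hj).le⟩
    have hle : lexLe (shift m (cut b k)) (mirror (cut b k)) :=
      ((shift_cut_lt hbk hkm).le.trans (Nat.find_spec hex)).trans (mirror_lexLt.2 hcb).le
    have h2 := heightSum_add_wordSum_le ht0.le ht1 hs hle
    have h3 := (abs_le.1 (abs_heightSum_le ht0.le hs (shift m (cut b k)))).1
    rw [heightSum_self, sum_cut_eq hkm, ← hP] at h1
    have h4 := sum_pow_le ht0.le ht1 m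
    have h5 : 0 ≤ ∑ j ∈ Finset.range m, t ^ j := Finset.sum_nonneg fun i _ => by positivity
    have h6 : 0 < t ^ m := by positivity
    have h7 : t ^ m ≤ 1 := pow_le_one₀ ht0.le ht1.le
    set S := wordSum (cut b k) t
    set F := heightSum (cut b k) (shift m (cut b k)) t
    have hS : 0 ≤ S := (abs_nonneg _).trans (abs_heightSum_le ht0.le hs (cut b k))
    have e : S * (1 - P + t ^ m) = ∑ j ∈ Finset.range m, t ^ j + t ^ m * (F + S) := by
      linear_combination h1
    rw [le_div_iff₀ (abs_pos.2 hD), ← abs_of_nonneg hS, ← abs_mul, e]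
    have h8 : 0 ≤ t ^ m * (F + S) := mul_nonneg h6.le (by linarith)
    have h9 : t ^ m * (F + S) ≤ 1 * (2 * (1 - t)⁻¹) :=
      mul_le_mul h7 h2 (by linarith) (by norm_num)
    rw [abs_of_nonneg (by linarith)]
    linarith
  · push Not at hex
    have hlt : ∀ j, lexLt (mirror b) (shift j b) := fun j => not_lexLe.1 (hex j)
    obtain ⟨t, ⟨hrt, htρ⟩, hD⟩ := exists_ne_zero_of_analytic
      (f := fun t => 1 - t * ∑' j, (2 * (b j : ℝ) - M) * t ^ j)
      (fun t ht => (analyticAt_const).sub (analyticAt_id.mul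
        (analyticOnNhd_tsum (abs_two_mul_digit_sub_le b) t ht))) (by simp) hr hrρ' hρ1
    have ht0 : 0 < t := hr.trans hrt
    have ht1 : t < 1 := htρ.trans hρ1
    set D := 1 - t * ∑' j, (2 * (b j : ℝ) - M) * t ^ j with hDdef
    have hsum : Summable fun j : ℕ => (2 * (b j : ℝ) - M) * t ^ j := by
      refine Summable.of_norm_bounded ((summable_geometric_of_lt_one ht0.le ht1).mul_left (M : ℝ))
        fun n => ?_
      rw [Real.norm_eq_abs, abs_mul, abs_of_nonneg (pow_nonneg ht0.le n)]
      exact mul_le_mul_of_nonneg_right (abs_two_mul_digit_sub_le b n) (by positivity)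
    have hlim : Filter.Tendsto (fun m => |1 - ∑ j ∈ Finset.range m,
        (2 * (b j : ℝ) - M) * t ^ (j + 1)| - t ^ m) Filter.atTop (nhds (|D| - 0)) := by
      refine Filter.Tendsto.sub (Filter.Tendsto.abs ?_) (tendsto_pow_atTop_nhds_zero_of_lt_one
        ht0.le ht1)
      refine tendsto_const_nhds.sub ?_
      refine (hsum.hasSum.tendsto_sum_nat.const_mul t).congr fun m => ?_
      rw [Finset.mul_sum]
      exact Finset.sum_congr rfl fun j _ => by ring
    have hD' : 0 < |D| := abs_pos.2 hD
    obtain ⟨m, hm⟩ := (hlim.eventually (lt_mem_nhds (by linarith : |D| / 2 < |D| - 0))).exists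
    set P := ∑ j ∈ Finset.range m, (2 * (b j : ℝ) - M) * t ^ (j + 1) with hP
    obtain ⟨k₀, hk₀⟩ := mirror_cut_lt_uniform (m := m) fun j _ => hlt j
    refine ⟨t, hrt, htρ.trans hρ', max k₀ m, (1 - t)⁻¹ / (|D| / 2), fun k hk hbk => ?_⟩
    have hkm : m ≤ k := le_of_max_le_right hk
    have hs := h (cut b k) (shift_cut_lt hbk (Nat.zero_le k)) t ht0 (htρ.trans hρ')
    have h1 := heightSum_iterate ht0.le hs m (c := cut b k) fun j hj =>
      ⟨shift_cut_le_cut hb hbk (by omega), (hk₀ k (le_of_max_le_left hk) j hj).le⟩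
    have h3 := abs_heightSum_le ht0.le hs (shift m (cut b k))
    rw [heightSum_self, sum_cut_eq hkm, ← hP] at h1
    have h4 := sum_pow_le ht0.le ht1 m
    have h5 : 0 ≤ ∑ j ∈ Finset.range m, t ^ j := Finset.sum_nonneg fun i _ => by positivity
    have h6 : 0 < t ^ m := by positivity
    set S := wordSum (cut b k) t
    set F := heightSum (cut b k) (shift m (cut b k)) t
    have hS : 0 ≤ S := (abs_nonneg _).trans h3
    have e : S * (1 - P) = ∑ j ∈ Finset.range m, t ^ j + t ^ m * F := by
      linear_combination h1
    have h7 : S * |1 - P| ≤ (1 - t)⁻¹ + t ^ m * S := by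
      rw [← abs_of_nonneg hS, ← abs_mul, e, abs_of_nonneg hS]
      refine (abs_add_le _ _).trans ?_
      rw [abs_mul, abs_of_nonneg h5, abs_of_pos h6]
      exact add_le_add h4 (mul_le_mul_of_nonneg_left h3 h6.le)
    rw [le_div_iff₀ (by positivity)]
    nlinarith [mul_le_mul_of_nonneg_left hm.le hS]

/-! ### Covers by cylinders and lower bounds for the Hausdorff dimension -/

/-- The sequences agreeing with `d` in the first `n` digits. -/
def cyl (d : Digits M) (n : ℕ) : Set (Digits M) := {e | ∀ i < n, e i = d i}

lemma isClopen_cyl (d : Digits M) (n : ℕ) : IsClopen (cyl d n) := by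
  have : cyl d n = ⋂ i ∈ Finset.range n, (fun e : Digits M => e i) ⁻¹' {d i} := by
    ext e; simp [cyl]
  rw [this]
  refine Set.Finite.isClopen_biInter (Finset.finite_toSet _) fun i _ => ?_
  exact (isClopen_discrete _).preimage (continuous_apply i)

lemma isClosed_pfx_mem_words (γ : Digits M) (m : ℕ) : IsClosed {d | pfx m d ∈ words γ m} := by
  have : {d | pfx m d ∈ words γ m} = ⋃ w ∈ words γ m, {d | pfx m d = w} := by
    ext d; simp
  rw [this]
  refine Set.Finite.isClosed_biUnion (Finset.finite_toSet _) fun w hw => ?_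
  obtain ⟨e, rfl⟩ := exists_of_mem_words hw
  simp only [pfx_eq_iff]
  exact (isClopen_cyl e m).isClosed

lemma V_eq_iInter (γ : Digits M) : V γ = ⋂ m, {d | pfx m d ∈ words γ m} := by
  ext d
  rw [mem_V_iff, Set.mem_iInter]
  rfl

lemma isCompact_V (γ : Digits M) : IsCompact (V γ) := by
  rw [V_eq_iInter]
  exact (isClosed_iInter fun m => isClosed_pfx_mem_words γ m).isCompact

lemma pfx_add (k l : ℕ) (d : Digits M) : pfx (l + k) d = pfx k d ++ pfx l (shift k d) := by
  induction k generalizing d with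
  | zero => simp [pfx]
  | succ k ih =>
    rw [← add_assoc, pfx, pfx, ih, shift_shift]
    rfl

lemma exists_bound_of_cover {γ : Digits M} {ρ : ℝ} (hρ : 0 < ρ) (A : Finset ℕ) (e : ℕ → Digits M)
    (k : ℕ → ℕ) (hk : ∀ i ∈ A, 1 ≤ k i) (hcov : V γ ⊆ ⋃ i ∈ A, cyl (e i) (k i))
    (hsum : ∑ i ∈ A, ρ ^ k i ≤ 1) : ∃ C, ∀ n, numWords γ n * ρ ^ n ≤ C := by
  obtain ⟨m, hm⟩ : ∃ m, {d | pfx m d ∈ words γ m} ⊆ ⋃ i ∈ A, cyl (e i) (k i) := by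
    refine exists_subset_nhds_of_isCompact (V := fun m => {d | pfx m d ∈ words γ m}) ?_
      (fun m => (isClosed_pfx_mem_words γ m).isCompact) fun d hd => ?_
    · refine directed_of_isDirected_le fun m n hmn d hd => ?_
      exact pfx_mem_words_of_le hmn hd
    · rw [← V_eq_iInter] at hd
      exact (isOpen_biUnion fun i _ => (isClopen_cyl _ _).isOpen).mem_nhds (hcov hd)
  set n₀ := m + ∑ i ∈ A, k i with hn₀
  set C := ∑ n ∈ Finset.range n₀, numWords γ n * ρ ^ n with hC
  have hterm : ∀ n, 0 ≤ numWords γ n * ρ ^ n := fun n => mul_nonneg (numWords_nonneg _ _)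
    (by positivity)
  have hC0 : 0 ≤ C := Finset.sum_nonneg fun n _ => hterm n
  refine ⟨C, fun n => ?_⟩
  induction n using Nat.strong_induction_on with
  | _ n ih =>
  rcases lt_or_ge n n₀ with hn | hn
  · exact Finset.single_le_sum (f := fun n => numWords γ n * ρ ^ n) (fun i _ => hterm i)
      (Finset.mem_range.2 hn)
  have hkn : ∀ i ∈ A, k i ≤ n := fun i hi =>
    (Finset.single_le_sum (fun i _ => Nat.zero_le (k i)) hi).trans (by omega)
  have hsub : words γ n ⊆
      A.biUnion fun i => (words γ (n - k i)).image fun u => pfx (k i) (e i) ++ u := by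
    intro w hw
    obtain ⟨d, rfl⟩ := exists_of_mem_words hw
    have hd := hm (pfx_mem_words_of_le (by omega : m ≤ n) hw : d ∈ {d | pfx m d ∈ words γ m})
    simp only [Set.mem_iUnion] at hd
    obtain ⟨i, hi, hd⟩ := hd
    rw [Finset.mem_biUnion]
    refine ⟨i, hi, Finset.mem_image.2 ⟨pfx (n - k i) (shift (k i) d), ?_, ?_⟩⟩
    · refine pfx_shift_mem_words ?_
      rwa [Nat.sub_add_cancel (hkn i hi)]
    · rw [← pfx_eq_iff.2 hd, ← pfx_add, Nat.sub_add_cancel (hkn i hi)]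
  have hcard : numWords γ n ≤ ∑ i ∈ A, numWords γ (n - k i) := by
    have h1 := (Finset.card_le_card hsub).trans Finset.card_biUnion_le
    have h2 := h1.trans (Finset.sum_le_sum fun i _ => Finset.card_image_le)
    simp only [numWords]
    exact_mod_cast h2
  calc numWords γ n * ρ ^ n ≤ (∑ i ∈ A, numWords γ (n - k i)) * ρ ^ n := by gcongr
    _ = ∑ i ∈ A, ρ ^ k i * (numWords γ (n - k i) * ρ ^ (n - k i)) := by
        rw [Finset.sum_mul]
        refine Finset.sum_congr rfl fun i hi => ?_
        rw [mul_left_comm, ← pow_add, Nat.add_sub_cancel' (hkn i hi)]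
    _ ≤ ∑ i ∈ A, ρ ^ k i * C := Finset.sum_le_sum fun i hi => by
        have := hk i hi
        have := hkn i hi
        exact mul_le_mul_of_nonneg_left (ih _ (by omega)) (by positivity)
    _ = (∑ i ∈ A, ρ ^ k i) * C := by rw [Finset.sum_mul]
    _ ≤ 1 * C := by gcongr
    _ = C := one_mul C

lemma exists_scale {q c D ε s : ℝ} (hq : 1 < q) (hc : 0 < c) (hs : 0 < s) (hε : 0 < ε) (hD0 : 0 ≤ D)
    (hD : D < c) :
    ∃ n : ℕ, 1 ≤ n ∧ (∀ k < n, D < c / q ^ k) ∧ ((q⁻¹) ^ s) ^ n ≤ (D / c) ^ s + ε := by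
  have hq0 : 0 < q := by linarith
  rcases hD0.eq_or_lt with rfl | hDpos
  · have h1 : (q⁻¹) ^ s < 1 := Real.rpow_lt_one (by positivity) (inv_lt_one_of_one_lt₀ hq) hs
    obtain ⟨n, hn⟩ := exists_pow_lt_of_lt_one hε h1
    refine ⟨n + 1, by omega, fun k _ => by positivity, ?_⟩
    have h2 : ((q⁻¹) ^ s) ^ (n + 1) ≤ ((q⁻¹) ^ s) ^ n :=
      pow_le_pow_of_le_one (by positivity) h1.le (by omega)
    have h3 : 0 ≤ (0 / c) ^ s := by positivity
    linarith
  · have hex : ∃ n : ℕ, c / q ^ n ≤ D := by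
      obtain ⟨n, hn⟩ := pow_unbounded_of_one_lt (c / D) hq
      refine ⟨n, ?_⟩
      rw [div_lt_iff₀ hDpos] at hn
      rw [div_le_iff₀ (by positivity)]
      linarith
    classical
    refine ⟨Nat.find hex, ?_, fun k hk => not_le.1 (Nat.find_min hex hk), ?_⟩
    · rw [Nat.one_le_iff_ne_zero]
      intro h0
      have := Nat.find_spec hex
      rw [h0, pow_zero, div_one] at this
      linarith
    · have h1 := Nat.find_spec hex
      set n := Nat.find hex
      have h2 : (q⁻¹) ^ n ≤ D / c := by
        rw [inv_pow, le_div_iff₀ hc, inv_mul_eq_div]; exact h1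
      have h3 : ((q⁻¹) ^ s) ^ n = ((q⁻¹) ^ n) ^ s := by
        rw [← Real.rpow_natCast, ← Real.rpow_natCast, ← Real.rpow_mul (by positivity),
          ← Real.rpow_mul (by positivity), mul_comm]
      rw [h3]
      have := Real.rpow_le_rpow (by positivity) h2 hs.le
      linarith

lemma exists_bound_of_dimH_lt {γ : Digits M} {q c : ℝ} (hq : 1 < q) (hc : 0 < c) (f : Digits M → ℝ)
    (hf : ∀ d ∈ V γ, ∀ e ∈ V γ, ∀ n, (∀ i < n, d i = e i) → d n ≠ e n → c / q ^ n ≤ |f d - f e|)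
    {s : ℝ≥0} (hs : dimH (f '' V γ) < s) :
    ∃ C, ∀ n, numWords γ n * ((q⁻¹) ^ (s : ℝ)) ^ n ≤ C := by
  have hs0 : 0 < (s : ℝ) := by
    rcases eq_or_ne s 0 with rfl | h
    · simp at hs
    · exact_mod_cast pos_iff_ne_zero.2 h
  have hμ := hausdorffMeasure_of_dimH_lt hs
  rw [MeasureTheory.Measure.hausdorffMeasure_apply] at hμ
  have hcpos : (0 : ℝ≥0∞) < ENNReal.ofReal (c / 2) := ENNReal.ofReal_pos.2 (by linarith)
  have hle : _ ≤ (0 : ℝ≥0∞) := (le_iSup₂ _ hcpos).trans hμ.le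
  have hlt := lt_of_le_of_lt hle (ENNReal.ofReal_pos.2 (by positivity : 0 < c ^ (s : ℝ) / 2))
  simp only [iInf_lt_iff] at hlt
  obtain ⟨t, hcov, hdiam, hsum⟩ := hlt
  set D : ℕ → ℝ := fun i => (Metric.ediam (t i)).toReal with hD
  have hfin : ∀ i, Metric.ediam (t i) ≠ ⊤ := fun i => ((hdiam i).trans_lt ENNReal.ofReal_lt_top).ne
  have hDlt : ∀ i, D i < c := fun i => by
    have := ENNReal.toReal_mono ENNReal.ofReal_ne_top (hdiam i)
    rw [ENNReal.toReal_ofReal (by positivity)] at this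
    linarith
  have hex := fun i : ℕ => exists_scale (ε := 1 / 2 / 2 / 2 ^ i) hq hc hs0 (by positivity)
    ENNReal.toReal_nonneg (hDlt i)
  choose k hk1 hk2 hk3 using hex
  set I : Set ℕ := {i | ∃ d ∈ V γ, f d ∈ t i}
  have : ∀ i, ∃ d, i ∈ I → d ∈ V γ ∧ f d ∈ t i := by
    intro i
    by_cases hi : i ∈ I
    · obtain ⟨d, hd⟩ := hi
      exact ⟨d, fun _ => hd⟩
    · exact ⟨fun _ => 0, fun h => absurd h hi⟩
  choose e he using this
  have hV : V γ ⊆ ⋃ i ∈ I, cyl (e i) (k i) := by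
    intro d hd
    obtain ⟨i, hi⟩ := Set.mem_iUnion.1 (hcov ⟨d, hd, rfl⟩)
    have hiI : i ∈ I := ⟨d, hd, hi⟩
    refine Set.mem_biUnion hiI ?_
    by_contra hnot
    have hex : ∃ n, d n ≠ e i n := by
      by_contra h
      push Not at h
      exact hnot fun j _ => h j
    classical
    set n := Nat.find hex
    have hn : ∀ j < n, d j = e i j := fun j hj => not_not.1 (Nat.find_min hex hj)
    have hnk : n < k i := by
      by_contra h
      exact hnot fun j hj => hn j (by omega)
    have h1 := hf d hd (e i) (he i hiI).1 n hn (Nat.find_spec hex)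
    have h2 : |f d - f (e i)| ≤ D i := by
      rw [← Real.dist_eq, dist_edist]
      exact ENNReal.toReal_mono (hfin i) (Metric.edist_le_ediam_of_mem hi (he i hiI).2)
    linarith [hk2 i n hnk]
  obtain ⟨A, hAI, hAfin, hAcov⟩ := (isCompact_V γ).elim_finite_subcover_image
    (fun i _ => (isClopen_cyl (e i) (k i)).isOpen) hV
  refine exists_bound_of_cover (by positivity) hAfin.toFinset e k (fun i _ => hk1 i)
    (by simpa using hAcov) ?_
  have h1 : ∑ i ∈ hAfin.toFinset, D i ^ (s : ℝ) ≤ c ^ (s : ℝ) / 2 := by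
    have h2 : ∑ i ∈ hAfin.toFinset, Metric.ediam (t i) ^ (s : ℝ) ≤
        ENNReal.ofReal (c ^ (s : ℝ) / 2) := by
      refine le_trans ?_ hsum.le
      refine le_trans (Finset.sum_le_sum fun i hi => ?_) (ENNReal.sum_le_tsum _)
      have hne : (t i).Nonempty := by
        obtain ⟨d, -, hd⟩ := hAI (hAfin.mem_toFinset.1 hi)
        exact ⟨_, hd⟩
      rw [ciSup_pos hne]
    have h3 := ENNReal.toReal_mono ENNReal.ofReal_ne_top h2
    rw [ENNReal.toReal_ofReal (by positivity), ENNReal.toReal_sum] at h3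
    · simpa only [← ENNReal.toReal_rpow] using h3
    · exact fun i _ => ENNReal.rpow_ne_top_of_nonneg hs0.le (hfin i)
  have h2 : ∑ i ∈ hAfin.toFinset, (1 / 2 / 2 / 2 ^ i : ℝ) ≤ 1 / 2 := by
    have := (summable_geometric_two' (1 / 2 : ℝ)).sum_le_tsum hAfin.toFinset
      (fun i _ => by positivity)
    rwa [tsum_geometric_two'] at this
  calc ∑ i ∈ hAfin.toFinset, ((q⁻¹) ^ (s : ℝ)) ^ k i
      ≤ ∑ i ∈ hAfin.toFinset, ((D i / c) ^ (s : ℝ) + 1 / 2 / 2 / 2 ^ i) :=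
        Finset.sum_le_sum fun i _ => hk3 i
    _ = (∑ i ∈ hAfin.toFinset, D i ^ (s : ℝ)) / c ^ (s : ℝ) +
        ∑ i ∈ hAfin.toFinset, (1 / 2 / 2 / 2 ^ i : ℝ) := by
        rw [Finset.sum_add_distrib, Finset.sum_div]
        congr 1
        exact Finset.sum_congr rfl fun i _ => Real.div_rpow ENNReal.toReal_nonneg hc.le _
    _ ≤ (c ^ (s : ℝ) / 2) / c ^ (s : ℝ) + 1 / 2 := by gcongr
    _ = 1 := by
        have : c ^ (s : ℝ) ≠ 0 := by positivity
        field_simp; norm_num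

/-! ### Upper bounds for the Hausdorff dimension -/

lemma dimH_le_of_forall_cover {E : Set ℝ} {θ C C' : ℝ} {s : ℝ≥0} (hθ : 0 < θ) (hθ1 : θ < 1)
    (hC' : 0 ≤ C')
    (h : ∀ n : ℕ, ∃ t : Finset ℝ, t.card * (θ ^ (s : ℝ)) ^ n ≤ C ∧
      E ⊆ ⋃ c ∈ t, Set.Icc c (c + C' * θ ^ n)) : dimH E ≤ s := by
  choose t ht hE using h
  refine dimH_le_of_hausdorffMeasure_ne_top (ne_top_of_le_ne_top
    (ENNReal.ofReal_ne_top (r := C' ^ (s : ℝ) * C)) ?_)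
  have hdiam : ∀ (n : ℕ) (c : ℝ), Metric.ediam (Set.Icc c (c + C' * θ ^ n)) =
      ENNReal.ofReal (C' * θ ^ n) := by
    intro n c
    rw [Real.ediam_Icc, add_sub_cancel_left]
  have hlim : Filter.Tendsto (fun n : ℕ => ENNReal.ofReal (C' * θ ^ n)) Filter.atTop (nhds 0) := by
    rw [← ENNReal.ofReal_zero]
    refine ENNReal.tendsto_ofReal ?_
    simpa using (tendsto_pow_atTop_nhds_zero_of_lt_one hθ.le hθ1).const_mul C'
  refine (MeasureTheory.Measure.hausdorffMeasure_le_liminf_sum (s : ℝ) E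
    (fun n : ℕ => ENNReal.ofReal (C' * θ ^ n)) hlim
    (fun n (c : t n) => Set.Icc (c : ℝ) (c + C' * θ ^ n)) (Filter.Eventually.of_forall fun n c => ?_)
    (Filter.Eventually.of_forall fun n => ?_)).trans ?_
  · exact (hdiam n c).le
  · intro y hy
    obtain ⟨c, hc⟩ := Set.mem_iUnion.1 (hE n hy)
    obtain ⟨hc, hy⟩ := Set.mem_iUnion.1 hc
    exact Set.mem_iUnion.2 ⟨⟨c, hc⟩, hy⟩
  · refine Filter.liminf_le_of_frequently_le' (Filter.Frequently.of_forall fun n => ?_)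
    simp only [hdiam, Finset.sum_const, Finset.card_univ, Fintype.card_coe, nsmul_eq_mul]
    rw [ENNReal.ofReal_rpow_of_nonneg (by positivity) (NNReal.coe_nonneg s), ← ENNReal.ofReal_natCast,
      ← ENNReal.ofReal_mul (by positivity)]
    refine ENNReal.ofReal_le_ofReal ?_
    rw [Real.mul_rpow hC' (by positivity), ← Real.rpow_natCast, ← Real.rpow_mul hθ.le,
      mul_comm (n : ℝ), Real.rpow_mul hθ.le, Real.rpow_natCast, mul_left_comm]
    exact mul_le_mul_of_nonneg_left (ht n) (by positivity)

lemma lexLe_shift_add_of_last (d : Digits M) (n : ℕ) (h : d n = Fin.last M) :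
    lexLe (shift (n + 1) d) (shift n d) := by
  rw [← mirror_lexLe, mirror_shift, mirror_shift]
  refine lexLe_shift_of_zero (mirror d) n 1 fun i h1 h2 => ?_
  obtain rfl : i = n := by omega
  rw [mirror_apply, h, Fin.rev_last]

lemma shift_lexLt_of_mem_UqSym {q : ℝ} (hq : 1 < q) (hqM : q ≤ M + 1) {b d : Digits M}
    (hb : IsQG q b) (hd : d ∈ UqSym M q) {i : ℕ} (hi : d i < Fin.last M) {n : ℕ} (hn : i + 1 ≤ n) :
    lexLt (shift n d) b := by
  induction n, hn using Nat.le_induction with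
  | base => exact hb.lexLt_of_piQ_lt hq (piQ_shift_lt_of_mem_UqSym hq hqM hd hi)
  | succ n hn ih =>
    rcases (Fin.le_last (d n)).lt_or_eq with h | h
    · exact hb.lexLt_of_piQ_lt hq (piQ_shift_lt_of_mem_UqSym hq hqM hd h)
    · exact (lexLe_shift_add_of_last d n h).trans_lt ih

lemma mirror_lexLt_shift_of_mem_UqSym {q : ℝ} (hq : 1 < q) (hqM : q ≤ M + 1) {b d : Digits M}
    (hb : IsQG q b) (hd : d ∈ UqSym M q) {i : ℕ} (hi : 0 < d i) {n : ℕ} (hn : i + 1 ≤ n) :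
    lexLt (mirror b) (shift n d) := by
  rw [lexLt_mirror_comm, mirror_shift]
  refine shift_lexLt_of_mem_UqSym hq hqM hb (mirror_mem_UqSym hq hd) (i := i) ?_ hn
  rw [mirror_apply, ← Fin.rev_zero]
  exact Fin.rev_lt_rev.2 hi

lemma shift_mem_V {γ d : Digits M} (hd : d ∈ V γ) (n : ℕ) : shift n d ∈ V γ := fun k => by
  rw [shift_shift]; exact hd _

lemma mirror_mem_V {γ d : Digits M} (hd : d ∈ V γ) : mirror d ∈ V γ := fun k => by
  rw [← mirror_shift, mirror_lexLe, lexLe_mirror_comm]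
  exact ⟨lexLe_mirror_comm.1 (lexLe_mirror_comm.1 (hd k).2), (hd k).1⟩

lemma abs_piQ_sub_le {q : ℝ} (hq : 1 < q) {c d : Digits M} {n : ℕ} (h : ∀ i < n, c i = d i) :
    |piQ M q c - piQ M q d| ≤ M / (q - 1) * (q⁻¹) ^ n := by
  have hq0 : 0 < q := by linarith
  rw [piQ_sub_piQ hq h, abs_div, abs_of_pos (pow_pos hq0 n), inv_pow, ← div_eq_mul_inv]
  gcongr
  rw [abs_le]
  have h1 := piQ_nonneg hq (shift n c)
  have h2 := piQ_le hq (shift n c)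
  have h3 := piQ_nonneg hq (shift n d)
  have h4 := piQ_le hq (shift n d)
  constructor <;> linarith

lemma dimH_piQ_image_V_le {q C : ℝ} (hq : 1 < q) {b : Digits M} {s : ℝ≥0}
    (h : ∀ n, numWords b n * ((q⁻¹) ^ (s : ℝ)) ^ n ≤ C) : dimH (piQ M q '' V b) ≤ s := by
  have hq0 : 0 < q := by linarith
  have hB : 0 ≤ (M : ℝ) / (q - 1) := div_nonneg (Nat.cast_nonneg M) (by linarith)
  refine dimH_le_of_forall_cover (θ := q⁻¹) (C := C) (C' := 2 * (M / (q - 1))) (by positivity)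
    (inv_lt_one_of_one_lt₀ hq) (by linarith) fun n => ?_
  choose! g hg using fun w (hw : w ∈ words b n) => exists_of_mem_words hw
  refine ⟨(words b n).image fun w => piQ M q (g w) - M / (q - 1) * (q⁻¹) ^ n, ?_, ?_⟩
  · refine le_trans ?_ (h n)
    rw [numWords]
    gcongr
    exact Finset.card_image_le
  · rintro _ ⟨d, hd, rfl⟩
    have hw := mem_V_iff.1 hd n
    refine Set.mem_biUnion (Finset.mem_image_of_mem _ hw) ?_
    have h1 := abs_le.1 (abs_piQ_sub_le hq (pfx_eq_iff.1 (hg _ hw).symm))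
    constructor <;> linarith [h1.1, h1.2]

lemma dimH_piQ_shift_mem_V_le {q : ℝ} (hq : 1 < q) {b : Digits M} {s : ℝ≥0∞}
    (h : dimH (piQ M q '' V b) ≤ s) (N : ℕ) : dimH (piQ M q '' {d | shift N d ∈ V b}) ≤ s := by
  have hq0 : q ≠ 0 := by positivity
  induction N with
  | zero => exact h
  | succ N ih =>
    have hsub : piQ M q '' {d | shift (N + 1) d ∈ V b} ⊆
        ⋃ a : Fin (M + 1), (fun y : ℝ => q⁻¹ * (a + y)) '' (piQ M q '' {d | shift N d ∈ V b}) := by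
      rintro _ ⟨d, hd, rfl⟩
      refine Set.mem_iUnion.2 ⟨d 0, _, ⟨shift 1 d, ?_, rfl⟩, ?_⟩
      · rw [Set.mem_ofPred_eq, shift_shift]; exact hd
      · have := piQ_cons hq d
        simp only
        rw [← this, inv_mul_cancel_left₀ hq0]
    refine (dimH_mono hsub).trans ?_
    rw [dimH_iUnion]
    refine iSup_le fun a => le_trans (LipschitzWith.dimH_image_le (K := ‖q⁻¹‖₊) ?_ _) ih
    refine LipschitzWith.of_dist_le_mul fun y z => ?_
    rw [Real.dist_eq, Real.dist_eq, coe_nnnorm, Real.norm_eq_abs, ← abs_mul]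
    exact le_of_eq (by ring_nf)

lemma dimH_Uq_le {q C : ℝ} (hq : 1 < q) (hqM : q ≤ M + 1) {b : Digits M} (hb : IsQG q b) {s : ℝ≥0}
    (h : ∀ n, numWords b n * ((q⁻¹) ^ (s : ℝ)) ^ n ≤ C) : dimH (Uq M q) ≤ s := by
  have hsub : Uq M q ⊆ {piQ M q (fun _ => 0), piQ M q (fun _ => Fin.last M)} ∪
      ⋃ N, piQ M q '' {d | shift N d ∈ V b} := by
    intro y hy
    obtain ⟨d, hd, rfl⟩ := exists_of_mem_Uq hy
    by_cases h0 : ∃ i, 0 < d i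
    · by_cases h1 : ∃ i, d i < Fin.last M
      · obtain ⟨i, hi⟩ := h0
        obtain ⟨j, hj⟩ := h1
        refine Or.inr (Set.mem_iUnion.2 ⟨max i j + 1, d, fun n => ?_, rfl⟩)
        rw [shift_shift]
        exact ⟨(shift_lexLt_of_mem_UqSym hq hqM hb hd hj (by omega)).le,
          (mirror_lexLt_shift_of_mem_UqSym hq hqM hb hd hi (by omega)).le⟩
      · push Not at h1
        have : d = fun _ => Fin.last M := funext fun i => le_antisymm (Fin.le_last _) (h1 i)
        subst this
        exact Or.inl (Or.inr rfl)
    · push Not at h0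
      have : d = fun _ => 0 := funext fun i => le_antisymm (h0 i) (Fin.zero_le _)
      subst this
      exact Or.inl (Or.inl rfl)
  refine (dimH_mono hsub).trans ?_
  rw [dimH_union, dimH_iUnion]
  refine max_le ?_ (iSup_le fun N => dimH_piQ_shift_mem_V_le hq (dimH_piQ_image_V_le hq h) N)
  rw [dimH_finite (by simp)]
  exact zero_le

/-! ### Separation of expansions below the quasi-greedy sequence -/

lemma exists_gap {q : ℝ} (hq : 1 < q) {b γ : Digits M} (hb : IsQG q b) (hγ : lexLt γ b) :
    ∃ η > 0, ∀ e ∈ V γ, piQ M q e ≤ 1 - η := by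
  rcases (V γ).eq_empty_or_nonempty with hV | hV
  · exact ⟨1, one_pos, by simp [hV]⟩
  obtain ⟨e, he, hmax⟩ := (isCompact_V γ).exists_isMaxOn hV (continuous_piQ hq).continuousOn
  have hmax : ∀ e' ∈ V γ, piQ M q e' ≤ piQ M q e := hmax
  suffices H : piQ M q e < 1 from
    ⟨1 - piQ M q e, by linarith, fun e' he' => by linarith [hmax e' he']⟩
  by_contra hge
  push Not at hge
  obtain ⟨n, hn, hlt⟩ := (he 0).1.trans_lt hγ
  rw [shift_zero] at hn hlt
  have h1 := piQ_sub_piQ_of_ne hq hn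
  have h2 := hmax _ (shift_mem_V he (n + 1))
  have h3 := hb.pos (n + 1)
  rw [hb.piQ_eq] at h1
  have h4 : ((e n : ℕ) : ℝ) + 1 ≤ (b n : ℕ) := by exact_mod_cast hlt
  have h5 : 1 ≤ q ^ (n + 1) := one_le_pow₀ hq.le
  nlinarith

lemma V_subset_UqSym {q η : ℝ} (hq : 1 < q) {γ : Digits M} (hη : 0 < η)
    (h : ∀ e ∈ V γ, piQ M q e ≤ 1 - η) : V γ ⊆ UqSym M q := fun _ hd =>
  mem_UqSym_of_forall hq (fun n _ => by linarith [h _ (shift_mem_V hd (n + 1))])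
    (fun n _ => by linarith [h _ (shift_mem_V (mirror_mem_V hd) (n + 1))])

lemma piQ_gap {q η : ℝ} (hq : 1 < q) {γ : Digits M} (h : ∀ e ∈ V γ, piQ M q e ≤ 1 - η)
    {d e : Digits M} (hd : d ∈ V γ) {n : ℕ} (hn : ∀ i < n, d i = e i) (hlt : d n < e n) :
    η / q / q ^ n ≤ piQ M q e - piQ M q d := by
  have h1 := piQ_sub_piQ_of_ne hq (fun i hi => (hn i hi).symm)
  have h2 := h _ (shift_mem_V hd (n + 1))
  have h3 := piQ_nonneg hq (shift (n + 1) e)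
  have h4 : ((d n : ℕ) : ℝ) + 1 ≤ (e n : ℕ) := by exact_mod_cast hlt
  rw [div_div, div_le_iff₀ (by positivity), ← pow_succ']
  linarith

lemma exists_bound_of_dimH_Uq_lt {q : ℝ} (hq : 1 < q) {b γ : Digits M} (hb : IsQG q b)
    (hγ : lexLt γ b) {s : ℝ≥0} (hs : dimH (Uq M q) < s) :
    ∃ C, ∀ n, numWords γ n * ((q⁻¹) ^ (s : ℝ)) ^ n ≤ C := by
  obtain ⟨η, hη, h⟩ := exists_gap hq hb hγ
  refine exists_bound_of_dimH_lt hq (c := η / q) (by positivity) (piQ M q) ?_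
    (lt_of_le_of_lt (dimH_mono ?_) hs)
  · intro d hd e he n hn hne
    rcases lt_or_gt_of_ne hne with hlt | hlt
    · rw [abs_sub_comm]
      exact (piQ_gap hq h hd hn hlt).trans (le_abs_self _)
    · exact (piQ_gap hq h he (fun i hi => (hn i hi).symm) hlt).trans (le_abs_self _)
  · rintro _ ⟨d, hd, rfl⟩
    exact piQ_mem_Uq (V_subset_UqSym hq hη h hd)

/-! ### Comparison of `𝒰_{q_x}` with the univoque bases of `x` -/

/-- Prepend `N` copies of the largest digit. -/
def prependLast (N : ℕ) (d : Digits M) : Digits M := fun i => if i < N then Fin.last M else d (i - N)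

lemma shift_prependLast (N n : ℕ) (d : Digits M) : shift (n + N) (prependLast N d) = shift n d := by
  funext i
  simp only [shift_apply, prependLast]
  rw [if_neg (by omega)]
  congr 1
  omega

lemma prependLast_of_lt {N i : ℕ} (h : i < N) (d : Digits M) : prependLast N d i = Fin.last M :=
  if_pos h

lemma prependLast_mem_UqSym {q η : ℝ} (hq : 1 < q) {γ d : Digits M} (hη : 0 < η)
    (h : ∀ e ∈ V γ, piQ M q e ≤ 1 - η) (hd : d ∈ V γ) (N : ℕ) : prependLast N d ∈ UqSym M q := by
  have key : ∀ k ≤ N, piQ M q (shift (N - k) (mirror (prependLast N d))) < 1 := by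
    intro k
    induction k with
    | zero =>
      intro _
      have e : shift N (mirror (prependLast N d)) = mirror d := by
        have := shift_prependLast N 0 d
        rw [zero_add, shift_zero] at this
        rw [← mirror_shift, this]
      rw [Nat.sub_zero, e]
      linarith [h _ (mirror_mem_V hd)]
    | succ k ih =>
      intro hk
      have h1 := ih (by omega)
      have h2 := piQ_cons hq (shift (N - (k + 1)) (mirror (prependLast N d)))
      rw [shift_shift, (by omega : 1 + (N - (k + 1)) = N - k), shift_apply, mirror_apply,
        prependLast_of_lt (by omega), Fin.rev_last] at h2
      have h3 := piQ_nonneg hq (shift (N - (k + 1)) (mirror (prependLast N d)))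
      simp only [Fin.coe_ofNat_eq_mod, Nat.zero_mod, Nat.cast_zero, zero_add] at h2
      nlinarith
  refine mem_UqSym_of_forall hq (fun n hn => ?_) (fun n _ => ?_)
  · have hnN : N ≤ n := by
      by_contra hlt
      rw [prependLast_of_lt (by omega)] at hn
      exact lt_irrefl _ hn
    rw [(by omega : n + 1 = (n - N + 1) + N), shift_prependLast]
    linarith [h _ (shift_mem_V hd (n - N + 1))]
  · rcases lt_or_ge n N with hn | hn
    · have := key (N - (n + 1)) (by omega)
      rwa [(by omega : N - (N - (n + 1)) = n + 1)] at this
    · rw [← mirror_shift, (by omega : n + 1 = (n - N + 1) + N), shift_prependLast]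
      linarith [h _ (mirror_mem_V (shift_mem_V hd (n - N + 1)))]

lemma exists_base_lt {Q η : ℝ} (hQ : 1 < Q) (hη : 0 < η) :
    ∃ p, 1 < p ∧ p < Q ∧ (M : ℝ) / (p - 1) < M / (Q - 1) + η := by
  have hcont : ContinuousAt (fun p : ℝ => (M : ℝ) / (p - 1)) Q := by
    have : Q - 1 ≠ 0 := by linarith
    fun_prop (disch := assumption)
  have hev := (hcont.eventually (gt_mem_nhds (by linarith : (M : ℝ) / (Q - 1) < M / (Q - 1) + η)))
  have h1 := (hev.filter_mono nhdsWithin_le_nhds).and (Ioo_mem_nhdsLT hQ)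
  obtain ⟨p, hp, hp1, hp2⟩ := h1.exists
  exact ⟨p, hp1, hp2, hp⟩

lemma exists_bound_of_dimH_Ubases_lt (hM : 0 < M) {x Q : ℝ} (hQ : 1 < Q) (hQM : Q ≤ M + 1)
    (hx : M / (Q - 1) = x) {b γ : Digits M} (hb : IsQG Q b) (hγ : lexLt γ b) {s : ℝ≥0}
    (hs : dimH (Ubases M x) < s) :
    ∃ C, ∀ n, numWords γ n * ((Q⁻¹) ^ (s : ℝ)) ^ n ≤ C := by
  have hMR : (0 : ℝ) < M := by exact_mod_cast hM
  obtain ⟨η, hη, hgap⟩ := exists_gap hQ hb hγ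
  obtain ⟨p, hp1, hpQ, hp⟩ := exists_base_lt (M := M) hQ (half_pos hη)
  have hgap' : ∀ q, p ≤ q → ∀ e ∈ V γ, piQ M q e ≤ 1 - η / 2 := by
    intro q hpq e he
    have h1 := piQ_anti hp1 hpq e
    have h2 := piQ_sub_le hp1 hpQ.le e
    linarith [hgap e he]
  have hxp : x < M / (p - 1) := by
    rw [← hx]
    exact div_lt_div_of_pos_left hMR (by linarith) (by linarith)
  have hp0 : 0 < (M : ℝ) / (p - 1) := div_pos hMR (by linarith)
  obtain ⟨N, hN⟩ := exists_pow_lt_of_lt_one (div_pos (sub_pos.2 hxp) hp0)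
    (inv_lt_one_of_one_lt₀ hp1)
  rw [lt_div_iff₀ hp0] at hN
  have hex : ∀ d ∈ V γ, ∃ q ∈ Set.Icc p Q, piQ M q (prependLast N d) = x := by
    intro d hd
    have hsub := intermediate_value_Icc' hpQ.le ((continuousOn_piQ (prependLast N d)).mono
      fun q hq => hp1.trans_le hq.1)
    refine hsub ⟨?_, ?_⟩
    · rw [← hx]; exact piQ_le hQ _
    · have h1 := abs_piQ_sub_le hp1 (n := N) fun i hi => prependLast_of_lt hi d
      have h2 := (abs_le.1 h1).1
      rw [piQ_const_top hp1] at h2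
      linarith
  choose! f hf hfx using hex
  set c := η / 2 / Q / Q ^ N * ((p - 1) ^ 2 / M) with hc
  have hp1' : 0 < p - 1 := by linarith
  have hQ0 : 0 < Q := by linarith
  have hcpos : 0 < c := by positivity
  have main : ∀ d ∈ V γ, ∀ e ∈ V γ, ∀ n, (∀ i < n, d i = e i) → d n < e n →
      c / Q ^ n ≤ f e - f d := by
    intro d hd e he n hn hlt
    obtain ⟨hpe, heQ⟩ := hf e he
    obtain ⟨hpd, hdQ⟩ := hf d hd
    have he1 : 1 < f e := by linarith
    have h0 : shift N (prependLast N e) = e := by simpa using shift_prependLast N 0 e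
    have h0' : shift N (prependLast N d) = d := by simpa using shift_prependLast N 0 d
    have h1 := piQ_gap he1 (hgap' _ hpe) hd hn hlt
    have h2 := piQ_sub_piQ he1 (c := prependLast N e) (d := prependLast N d) (n := N) fun i hi => by
      rw [prependLast_of_lt hi, prependLast_of_lt hi]
    rw [h0, h0', hfx e he] at h2
    have h3 : η / 2 / Q / Q ^ n / Q ^ N ≤ x - piQ M (f e) (prependLast N d) := by
      rw [h2]
      have : η / 2 / Q / Q ^ n / Q ^ N ≤ η / 2 / f e / f e ^ n / f e ^ N := by gcongr
      refine this.trans ?_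
      gcongr
    have h4 : 0 < η / 2 / Q / Q ^ n / Q ^ N := by positivity
    have hde : f d < f e := by
      by_contra hge
      have := piQ_anti he1 (not_lt.1 hge) (prependLast N d)
      rw [hfx d hd] at this
      linarith
    have h5 := piQ_sub_le (by linarith : 1 < f d) hde.le (prependLast N d)
    rw [hfx d hd] at h5
    have h6 : M / (f d - 1) - M / (f e - 1) ≤ M * (f e - f d) / (p - 1) ^ 2 := by
      have hd0 : 0 < f d - 1 := by linarith
      have he0 : 0 < f e - 1 := by linarith
      rw [div_sub_div _ _ hd0.ne' he0.ne']
      have : (M : ℝ) * (f e - 1) - (f d - 1) * M = M * (f e - f d) := by ring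
      rw [this]
      refine div_le_div_of_nonneg_left (by nlinarith) (by positivity) ?_
      rw [sq]
      exact mul_le_mul (by linarith) (by linarith) hp1'.le hd0.le
    have h7 : η / 2 / Q / Q ^ n / Q ^ N ≤ M * (f e - f d) / (p - 1) ^ 2 := by linarith
    rw [le_div_iff₀ (by positivity)] at h7
    have h8 : c / Q ^ n = η / 2 / Q / Q ^ n / Q ^ N * (p - 1) ^ 2 / M := by rw [hc]; ring
    rw [h8, div_le_iff₀ hMR]
    linarith
  refine exists_bound_of_dimH_lt hQ hcpos f ?_ (lt_of_le_of_lt (dimH_mono ?_) hs)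
  · intro d hd e he n hn hne
    rcases lt_or_gt_of_ne hne with hlt | hlt
    · rw [abs_sub_comm]
      exact (main d hd e he n hn hlt).trans (le_abs_self _)
    · exact (main e he d hd n (fun i hi => (hn i hi).symm) hlt).trans (le_abs_self _)
  · rintro _ ⟨d, hd, rfl⟩
    obtain ⟨hpd, hdQ⟩ := hf d hd
    have hd1 : 1 < f d := by linarith
    refine ⟨⟨hd1, hdQ.trans hQM⟩, ?_⟩
    have h := piQ_mem_Uq (prependLast_mem_UqSym hd1 (half_pos hη) (hgap' _ hpd) hd N)
    rwa [hfx d hd] at h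

lemma IsQG.not_endsInZero {q : ℝ} {b : Digits M} (hb : IsQG q b) : ¬ EndsInZero b := by
  rintro ⟨N, hN⟩
  have h := hb.pos N
  have : shift N b = fun _ => 0 := funext fun i => hN (i + N) (by omega)
  rw [this] at h
  simp [piQ] at h

lemma summable_of_bound {γ : Digits M} {ρ C t : ℝ} (h : ∀ n, numWords γ n * ρ ^ n ≤ C) (ht : 0 < t)
    (htρ : t < ρ) : Summable fun n => numWords γ n * t ^ n := by
  have hρ : 0 < ρ := ht.trans htρ
  refine Summable.of_nonneg_of_le (fun n => mul_nonneg (numWords_nonneg _ _) (by positivity))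
    (fun n => ?_) ((summable_geometric_of_lt_one (by positivity)
      ((div_lt_one hρ).2 htρ)).mul_left C)
  calc numWords γ n * t ^ n = numWords γ n * ρ ^ n * (t / ρ) ^ n := by
        rw [div_pow]; field_simp
    _ ≤ C * (t / ρ) ^ n := mul_le_mul_of_nonneg_right (h n) (by positivity)

lemma dimH_Uq_le_dimH_Ubases (hM : 0 < M) {x Q : ℝ} (hQ : 1 < Q) (hQM : Q ≤ M + 1)
    (hx : M / (Q - 1) = x) {b : Digits M} (hb : IsQG Q b) (hbm : lexLt (mirror b) b) :
    dimH (Uq M Q) ≤ dimH (Ubases M x) := by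
  refine le_of_forall_gt fun a ha => ?_
  obtain ⟨s, hs, hsa⟩ := ENNReal.lt_iff_exists_nnreal_btwn.1 ha
  obtain ⟨s', hss', hs'a⟩ := ENNReal.lt_iff_exists_nnreal_btwn.1 hsa
  refine lt_of_le_of_lt ?_ hs'a
  have hQ1 : Q⁻¹ < 1 := inv_lt_one_of_one_lt₀ hQ
  have hQ0 : 0 < Q⁻¹ := by positivity
  obtain ⟨C, hC⟩ := exists_bound_of_truncations (hb.shift_lexLe hQ) hbm hb.not_endsInZero
    (ρ := (Q⁻¹) ^ (s : ℝ)) (Real.rpow_le_one hQ0.le hQ1.le s.coe_nonneg) (fun γ hγ t ht htρ => by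
      obtain ⟨C, hC⟩ := exists_bound_of_dimH_Ubases_lt hM hQ hQM hx hb hγ hs
      exact summable_of_bound hC ht htρ) (r := (Q⁻¹) ^ (s' : ℝ)) (by positivity)
      (Real.rpow_lt_rpow_of_exponent_gt hQ0 hQ1 (by exact_mod_cast hss'))
  exact dimH_Uq_le hQ hQM hb hC

/-! ### Positivity of the dimension of `𝒰_{q_x}` -/

lemma lexLe_of_pfx_le {c d : Digits M} {n : ℕ} (h : pfx n c ≤ pfx n d)
    (h' : lexLe (shift n c) (shift n d)) : lexLe c d := by
  rcases h.lt_or_eq with h | h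
  · obtain ⟨k, -, hk⟩ := pfx_lt_iff.1 h
    exact lexLt.le ⟨k, hk⟩
  · rw [pfx_eq_iff] at h
    rcases h' with e | ⟨k, hk, hlt⟩
    · refine Or.inl (funext fun i => ?_)
      rcases lt_or_ge i n with hi | hi
      · exact h i hi
      · have := congrFun e (i - n)
        simpa only [shift_apply, Nat.sub_add_cancel hi] using this
    · refine lexLt.le ⟨k + n, fun i hi => ?_, hlt⟩
      rcases lt_or_ge i n with hin | hin
      · exact h i hin
      · have := hk (i - n) (by omega)
        simpa only [shift_apply, Nat.sub_add_cancel hin] using this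

/-- There are arbitrarily long prefixes of `a` all of whose proper tails strictly exceed the
reflection of the prefix. -/
lemma exists_strict_prefix {a : Digits M} (ha1 : ∀ j, lexLe (shift j a) a)
    (ha2 : ∀ j ≥ 1, lexLt (mirror a) (shift j a)) (N : ℕ) (hN : 1 ≤ N) :
    ∃ m > N, ∀ j, 1 ≤ j → j < m → pfx (m - j) (mirror a) < pfx (m - j) (shift j a) := by
  choose! D hD using ha2
  obtain ⟨i, hi, hmax⟩ := Finset.exists_max_image (Finset.Icc 1 N) (fun i => i + D i)
    ⟨1, Finset.mem_Icc.2 ⟨le_refl _, hN⟩⟩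
  rw [Finset.mem_Icc] at hi
  refine ⟨i + D i + 1, ?_, fun j hj hjm => pfx_lt_iff.2 ?_⟩
  · have := hmax N (Finset.mem_Icc.2 ⟨hN, le_refl _⟩)
    omega
  · rcases le_or_gt j N with hjN | hjN
    · have := hmax j (Finset.mem_Icc.2 ⟨hj, hjN⟩)
      exact ⟨D j, by omega, hD j hj⟩
    · obtain ⟨t, rfl⟩ : ∃ t, j = i + t := ⟨j - i, by omega⟩
      obtain ⟨h1, h2⟩ := hD i hi.1
      have hle := lexLe_iff_pfx.1 (ha1 t) (D i + 1 - t)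
      have big : (∀ n < D i - t, a (n + t) = a n) → a (D i - t + t) ≤ a (D i - t) →
          ∃ k < i + D i + 1 - (i + t), (∀ l < k, mirror a l = shift (i + t) a l) ∧
            mirror a k < shift (i + t) a k := by
        intro hn hk
        refine ⟨D i - t, by omega, fun l hl => ?_, ?_⟩
        · have := h1 (l + t) (by omega)
          rw [mirror_apply, hn l hl] at this
          rw [mirror_apply, this, shift_apply, shift_apply]
          congr 1
          omega
        · have e : D i - t + t = D i := by omega
          rw [e] at hk
          simp only [mirror_apply, shift_apply] at h2 ⊢
          rw [(by omega : D i - t + (i + t) = D i + i)]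
          exact (Fin.rev_le_rev.2 hk).trans_lt h2
      rcases hle.lt_or_eq with h | h
      · obtain ⟨n, hn, hna, hnlt⟩ := pfx_lt_iff.1 h
        simp only [shift_apply] at hna hnlt
        rcases lt_or_ge n (D i - t) with hnk | hnk
        · refine ⟨n, by omega, fun l hl => ?_, ?_⟩
          · have := h1 (l + t) (by omega)
            rw [mirror_apply, hna l hl] at this
            rw [mirror_apply, this, shift_apply, shift_apply]
            congr 1
            omega
          · have := h1 (n + t) (by omega)
            simp only [mirror_apply, shift_apply] at this ⊢
            rw [(by omega : n + (i + t) = n + t + i), ← this]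
            exact Fin.rev_lt_rev.2 hnlt
        · obtain rfl : n = D i - t := by omega
          exact big hna hnlt.le
      · rw [pfx_eq_iff] at h
        exact big (fun n hn => h n (by omega)) (h _ (by omega)).le

/-- The sequence `(a_1 … a_m a_{m+1}^-)^∞`. -/
def lowered (a : Digits M) (m : ℕ) : Digits M := fun i => cut a m (i % (m + 1))

/-- The sequence `a_1 … a_{m+1}` followed by the reflection of `(a_1 … a_m a_{m+1}^-)^∞`. -/
def prefixed (a : Digits M) (m : ℕ) : Digits M := fun i =>
  if i < m + 1 then a i else mirror (lowered a m) (i - (m + 1))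

lemma shift_lowered (a : Digits M) (m : ℕ) : shift (m + 1) (lowered a m) = lowered a m := by
  funext i
  simp only [shift_apply, lowered, Nat.add_mod_right]

lemma lowered_of_lt (a : Digits M) {m i : ℕ} (h : i < m + 1) : lowered a m i = cut a m i := by
  rw [lowered, Nat.mod_eq_of_lt h]

lemma prefixed_of_lt (a : Digits M) {m i : ℕ} (h : i < m + 1) : prefixed a m i = a i := if_pos h

lemma shift_prefixed (a : Digits M) (m : ℕ) :
    shift (m + 1) (prefixed a m) = mirror (lowered a m) := by
  funext i
  rw [shift_apply, prefixed, if_neg (by omega), Nat.add_sub_cancel]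

section
variable {a : Digits M} {m : ℕ} (ha1 : ∀ j, lexLe (shift j a) a)
  (h : ∀ j, 1 ≤ j → j < m + 1 → pfx (m + 1 - j) (mirror a) < pfx (m + 1 - j) (shift j a))
  (hm : 1 ≤ m)

include h hm in
lemma mirror_zero_lt_of_strict : mirror a 0 < a m := by
  obtain ⟨k, hk, -, hlt⟩ := pfx_lt_iff.1 (h m hm (by omega))
  obtain rfl : k = 0 := by omega
  simpa using hlt

include h hm in
lemma pos_of_strict : 0 < a m := (Fin.zero_le _).trans_lt (mirror_zero_lt_of_strict h hm)

include ha1 h hm in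
lemma mirror_zero_lt_zero : mirror a 0 < a 0 := by
  refine (mirror_zero_lt_of_strict h hm).trans_le ?_
  have := lexLe_iff_pfx.1 (ha1 m) 1
  rw [pfx, pfx.eq_2 a, cons_le_cons_iff, shift_apply, zero_add] at this
  exact this.elim le_of_lt fun h => h.1.le

include h in
lemma mirror_lowered_le {j : ℕ} (hj : 1 ≤ j) (hjm : j < m + 1) :
    lexLe (mirror (lowered a m)) (shift (m + 1 - j) (prefixed a m)) := by
  obtain ⟨k, hk, he, hlt⟩ := pfx_lt_iff.1 (h (m + 1 - j) (by omega) (by omega))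
  refine lexLt.le ⟨k, fun i hi => ?_, ?_⟩
  · have := he i hi
    simp only [mirror_apply, shift_apply] at this ⊢
    rw [lowered_of_lt a (by omega), cut_of_lt a (by omega), prefixed_of_lt a (by omega), this]
  · simp only [mirror_apply, shift_apply] at hlt ⊢
    rwa [lowered_of_lt a (by omega), cut_of_lt a (by omega), prefixed_of_lt a (by omega)]

lemma pfx_prefixed (a : Digits M) {m n : ℕ} (hn : n ≤ m + 1) : pfx n (prefixed a m) = pfx n a :=
  pfx_eq_iff.2 fun _ hi => prefixed_of_lt a (by omega)

lemma pfx_shift_prefixed (a : Digits M) (m j : ℕ) :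
    pfx (m + 1 - j) (shift j (prefixed a m)) = pfx (m + 1 - j) (shift j a) :=
  pfx_eq_iff.2 fun _ hi => prefixed_of_lt a (by omega)

include ha1 h in
lemma shift_prefixed_le {j : ℕ} (hj : j < m + 1) :
    lexLe (shift j (prefixed a m)) (prefixed a m) := by
  rcases Nat.eq_zero_or_pos j with rfl | hj0
  · exact lexLe_refl _
  refine lexLe_of_pfx_le (n := m + 1 - j) ?_ ?_
  · rw [pfx_shift_prefixed, pfx_prefixed a (by omega)]
    exact lexLe_iff_pfx.1 (ha1 j) _
  · rw [shift_shift, Nat.sub_add_cancel hj.le, shift_prefixed]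
    exact mirror_lowered_le h hj0 hj

include ha1 h hm in
lemma mirror_prefixed_le {j : ℕ} (hj : j < m + 1) :
    lexLe (mirror (prefixed a m)) (shift j (prefixed a m)) := by
  rcases Nat.eq_zero_or_pos j with rfl | hj0
  · refine lexLt.le ⟨0, by simp, ?_⟩
    rw [shift_zero, mirror_apply, prefixed_of_lt a (by omega)]
    exact mirror_zero_lt_zero ha1 h hm
  · obtain ⟨k, hk, he, hlt⟩ := pfx_lt_iff.1 (h j hj0 hj)
    refine lexLt.le ⟨k, fun i hi => ?_, ?_⟩
    · have := he i hi
      simp only [mirror_apply, shift_apply] at this ⊢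
      rw [prefixed_of_lt a (by omega), prefixed_of_lt a (by omega), this]
    · simp only [mirror_apply, shift_apply] at hlt ⊢
      rwa [prefixed_of_lt a (by omega), prefixed_of_lt a (by omega)]

include ha1 h hm in
lemma shift_lowered_le {j : ℕ} (hj : j < m + 1) :
    lexLe (shift j (lowered a m)) (prefixed a m) := by
  have e : pfx (m + 1 - j) (shift j (cut a m)) < pfx (m + 1 - j) (shift j a) := by
    refine pfx_lt_iff.2 ⟨m - j, by omega, fun i hi => cut_of_lt a (by omega), ?_⟩
    simp only [shift_apply, (by omega : m - j + j = m)]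
    exact cut_self_lt (pos_of_strict h hm)
  have e1 : pfx (m + 1 - j) (shift j (lowered a m)) = pfx (m + 1 - j) (shift j (cut a m)) :=
    pfx_eq_iff.2 fun i hi => lowered_of_lt a (by omega)
  have e2 := lexLe_iff_pfx.1 (ha1 j) (m + 1 - j)
  rw [← pfx_prefixed a (by omega : m + 1 - j ≤ m + 1)] at e2
  rw [← e1] at e
  obtain ⟨k, -, hk⟩ := pfx_lt_iff.1 (e.trans_le e2)
  exact lexLt.le ⟨k, hk⟩

include ha1 h hm in
lemma mirror_prefixed_le_shift_lowered {j : ℕ} (hj : j < m + 1) :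
    lexLe (mirror (prefixed a m)) (shift j (lowered a m)) := by
  rcases Nat.eq_zero_or_pos j with rfl | hj0
  · refine lexLt.le ⟨0, by simp, ?_⟩
    rw [shift_zero, mirror_apply, prefixed_of_lt a (by omega), lowered_of_lt a (by omega),
      cut_of_lt a (by omega)]
    exact mirror_zero_lt_zero ha1 h hm
  · obtain ⟨k, hk, he, hlt⟩ := pfx_lt_iff.1 (h j hj0 hj)
    have hag : ∀ i < k, mirror (prefixed a m) i = shift j (lowered a m) i := by
      intro i hi
      have := he i hi
      simp only [mirror_apply, shift_apply] at this ⊢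
      rw [prefixed_of_lt a (by omega), lowered_of_lt a (by omega), cut_of_lt a (by omega), this]
    simp only [mirror_apply, shift_apply] at hlt
    rcases lt_or_ge (k + j) m with hkm | hkm
    · refine lexLt.le ⟨k, hag, ?_⟩
      simp only [mirror_apply, shift_apply]
      rwa [prefixed_of_lt a (by omega), lowered_of_lt a (by omega), cut_of_lt a (by omega)]
    · obtain rfl : k = m - j := by omega
      refine lexLe_of_pfx_le (n := m + 1 - j) ?_ ?_
      · have hle : mirror (prefixed a m) (m - j) ≤ shift j (lowered a m) (m - j) := by
          simp only [mirror_apply, shift_apply, (by omega : m - j + j = m)] at hlt ⊢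
          rw [prefixed_of_lt a (by omega), lowered_of_lt a (by omega), cut, if_neg (lt_irrefl m),
            if_pos rfl, Fin.le_def]
          rw [Fin.lt_def] at hlt
          simp only
          omega
        rcases hle.lt_or_eq with hlt' | heq
        · exact (pfx_lt_iff.2 ⟨_, by omega, hag, hlt'⟩).le
        · refine (pfx_eq_iff.2 fun i hi => ?_).le
          rcases lt_or_ge i (m - j) with hi' | hi'
          · exact hag i hi'
          · obtain rfl : i = m - j := by omega
            exact heq
      · rw [shift_shift, Nat.sub_add_cancel hj.le, shift_lowered, ← mirror_shift,
          lexLe_mirror_comm]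
        exact mirror_lowered_le h hj0 hj

include ha1 h hm in
/-- The language defined by `prefixed a m` has entropy at least `log 2 / (m + 1)`. -/
lemma not_summable_prefixed {r : ℝ} (hr : 0 < r) (hrm : 2 * r ^ (m + 1) = 1) :
    ¬ Summable fun n => numWords (prefixed a m) n * r ^ n := by
  intro hs
  have h1 := heightSum_iterate hr.le hs (m + 1) (c := prefixed a m) fun j hj =>
    ⟨shift_prefixed_le ha1 h hj, mirror_prefixed_le ha1 h hm hj⟩
  have h2 := heightSum_iterate hr.le hs (m + 1) (c := mirror (lowered a m)) fun j hj => by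
    rw [← mirror_shift, mirror_lexLe, lexLe_mirror_comm]
    exact ⟨mirror_prefixed_le_shift_lowered ha1 h hm hj, shift_lowered_le ha1 h hm hj⟩
  rw [heightSum_self, shift_prefixed] at h1
  rw [← mirror_shift, shift_lowered] at h2
  have hP : ∑ j ∈ Finset.range (m + 1), (2 * (mirror (lowered a m) j : ℝ) - M) * r ^ (j + 1) =
      -∑ j ∈ Finset.range (m + 1), (2 * (prefixed a m j : ℝ) - M) * r ^ (j + 1) +
        2 * r ^ (m + 1) := by
    rw [Finset.sum_range_succ, Finset.sum_range_succ, neg_add, add_assoc,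
      ← Finset.sum_neg_distrib]
    congr 1
    · refine Finset.sum_congr rfl fun j hj => ?_
      have hj := Finset.mem_range.1 hj
      rw [val_mirror, lowered_of_lt a (by omega), cut_of_lt a hj, prefixed_of_lt a (by omega)]
      ring
    · have hpos : 1 ≤ (a m : ℕ) := pos_of_strict h hm
      rw [val_mirror, lowered_of_lt a (by omega), prefixed_of_lt a (by omega), cut,
        if_neg (lt_irrefl m), if_pos rfl]
      push_cast [Nat.cast_sub hpos]
      ring
  rw [hP] at h2
  have hA : 0 < ∑ j ∈ Finset.range (m + 1), r ^ j :=
    Finset.sum_pos (fun i _ => by positivity) ⟨0, by simp⟩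
  have hr' : r ^ (m + 1) = 1 / 2 := by linarith
  rw [hr'] at h1 h2
  linarith

end

lemma dimH_Uq_pos {Q : ℝ} (hQ : 1 < Q) {a b : Digits M} (hb : IsQG Q b)
    (ha1 : ∀ j, lexLe (shift j a) a) (ha2 : ∀ j ≥ 1, lexLt (mirror a) (shift j a))
    (hab : lexLt a b) : 0 < dimH (Uq M Q) := by
  obtain ⟨N, hN, hlt⟩ := hab
  obtain ⟨m, hm, h⟩ := exists_strict_prefix ha1 ha2 (N + 1) (by omega)
  obtain ⟨m, rfl⟩ : ∃ m', m = m' + 1 := ⟨m - 1, by omega⟩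
  have hγ : lexLt (prefixed a m) b :=
    ⟨N, fun i hi => by rw [prefixed_of_lt a (by omega), hN i hi],
      by rwa [prefixed_of_lt a (by omega)]⟩
  set r : ℝ := (1 / 2) ^ (1 / ((m + 1 : ℕ) : ℝ)) with hr
  have hr0 : 0 < r := by positivity
  have hrm : 2 * r ^ (m + 1) = 1 := by
    rw [hr, one_div ((m + 1 : ℕ) : ℝ), Real.rpow_inv_natCast_pow (by norm_num) (by omega)]
    norm_num
  have hr1 : r < 1 := Real.rpow_lt_one (by norm_num) (by norm_num) (by positivity)
  have hQ0 : 0 < Q := by linarith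
  have hlogQ : 0 < Real.log Q := Real.log_pos hQ
  have hlogr : Real.log r < 0 := Real.log_neg hr0 hr1
  have hv : 0 < -Real.log r / 2 / Real.log Q := div_pos (by linarith) hlogQ
  obtain ⟨s, hs⟩ : ∃ s : ℝ≥0, (s : ℝ) = -Real.log r / 2 / Real.log Q :=
    ⟨Real.toNNReal _, Real.coe_toNNReal _ hv.le⟩
  have hs0 : 0 < s := by rwa [← NNReal.coe_pos, hs]
  by_contra hcon
  have hdim : dimH (Uq M Q) < s := by
    rw [nonpos_iff_eq_zero.1 (not_lt.1 hcon)]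
    exact_mod_cast hs0
  obtain ⟨C, hC⟩ := exists_bound_of_dimH_Uq_lt hQ hb hγ hdim
  refine not_summable_prefixed ha1 h (by omega) hr0 hrm (summable_of_bound hC hr0 ?_)
  rw [← Real.log_lt_log_iff hr0 (by positivity), Real.log_rpow (x := Q⁻¹) (by positivity),
    Real.log_inv, hs]
  have : -Real.log r / 2 / Real.log Q * -Real.log Q = Real.log r / 2 := by
    field_simp
  linarith

/-! ### The base `q_x` for `1 < x < x_KL` -/

lemma qx_spec (hM : 0 < M) {x : ℝ} (hx : x ∈ Set.Ioo 1 (xKL M)) :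
    1 < qx M x ∧ qx M x < M + 1 ∧ M / (qx M x - 1) = x ∧ ∃ q ∈ Ubases M 1, q < qx M x := by
  obtain ⟨hx1, hx2⟩ := hx
  have hMR : (0 : ℝ) < M := by exact_mod_cast hM
  have hx0 : 0 < x := by linarith
  have hMx : 0 < (M : ℝ) / x := by positivity
  have hlt : (M : ℝ) / x < M := div_lt_self hMR hx1
  have hq : qx M x = 1 + M / x := min_eq_right (by linarith)
  rw [hq]
  refine ⟨by linarith, by linarith, ?_, ?_⟩
  · rw [add_sub_cancel_left, div_div_cancel₀ hMR.ne']
  have hK : 0 < qKL M - 1 := by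
    by_contra hcon
    have : xKL M ≤ 0 := div_nonpos_of_nonneg_of_nonpos hMR.le (not_lt.1 hcon)
    linarith
  have hne : (Ubases M 1).Nonempty := by
    by_contra hcon
    rw [qKL, Set.not_nonempty_iff_eq_empty.1 hcon, Real.sInf_empty] at hK
    linarith
  rw [xKL, lt_div_iff₀ hK] at hx2
  refine exists_lt_of_csInf_lt hne ?_
  have : qKL M - 1 < M / x := by
    rw [lt_div_iff₀ hx0]
    linarith
  rw [← qKL]
  linarith

lemma exists_univoque_expansion_one (hM : 0 < M) {q : ℝ} (hq : q ∈ Ubases M 1) :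
    ∃ a : Digits M, piQ M q a = 1 ∧ (∀ j, lexLe (shift j a) a) ∧
      ∀ j ≥ 1, lexLt (mirror a) (shift j a) := by
  obtain ⟨⟨hq1, hqM⟩, hU⟩ := hq
  obtain ⟨a, ha, hpa⟩ := exists_of_mem_Uq hU
  obtain ⟨a', ha'⟩ := exists_isQG hq1 hqM
  obtain rfl : a' = a := ha a' (ha'.piQ_eq.trans hpa.symm)
  refine ⟨a', hpa, ha'.shift_lexLe hq1, fun j hj =>
    mirror_lexLt_shift_of_mem_UqSym hq1 hqM ha' ha (i := 0) ?_ hj⟩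
  by_contra hcon
  have h0 : a' 0 = 0 := le_antisymm (not_lt.1 hcon) (Fin.zero_le _)
  have h1 : piQ M q (shift 1 a') < 1 := by
    refine piQ_shift_lt_of_mem_UqSym hq1 hqM ha (n := 0) ?_
    rw [h0, Fin.lt_def]
    exact hM
  have h2 := piQ_cons hq1 a'
  rw [hpa, h0] at h2
  simp only [Fin.coe_ofNat_eq_mod, Nat.zero_mod, Nat.cast_zero, zero_add, mul_one] at h2
  linarith

lemma IsQG.lexLt_of_lt {p q : ℝ} {a b : Digits M} (hb : IsQG q b) (hp : 1 < p) (hpq : p < q)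
    (ha : piQ M p a = 1) : lexLt a b := by
  refine hb.lexLt_of_piQ_lt (hp.trans hpq) ?_
  have h := piQ_scale hp hpq.le a
  rw [ha] at h
  by_contra hge
  nlinarith

/-! ### Upper bound by the dimensions of the sets `𝒰_q` -/

lemma dimH_le_of_abs_sub_le {B : Set ℝ} {g : ℝ → ℝ} {C : ℝ} {E : ℝ≥0} (hE : 0 < E)
    (h : ∀ u ∈ B, ∀ v ∈ B, |u - v| ≤ C * |g u - g v| ^ ((E⁻¹ : ℝ≥0) : ℝ)) :
    dimH B ≤ E * dimH (g '' B) := by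
  have hE' : 0 < E⁻¹ := inv_pos.2 hE
  have hinj : Set.InjOn g B := by
    intro u hu v hv huv
    have := h u hu v hv
    rw [huv, sub_self, abs_zero, Real.zero_rpow (by exact_mod_cast hE'.ne'), mul_zero] at this
    exact sub_eq_zero.1 (abs_nonpos_iff.1 this)
  have hold : HolderOnWith C.toNNReal E⁻¹ (Function.invFunOn g B) (g '' B) := by
    rintro _ ⟨u, hu, rfl⟩ _ ⟨v, hv, rfl⟩
    rw [hinj.leftInvOn_invFunOn hu, hinj.leftInvOn_invFunOn hv, edist_dist, edist_dist,
      Real.dist_eq, Real.dist_eq, ENNReal.ofReal_rpow_of_nonneg (abs_nonneg _) (E⁻¹).coe_nonneg,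
      ← ENNReal.ofReal_coe_nnreal, ← ENNReal.ofReal_mul (NNReal.coe_nonneg _)]
    refine ENNReal.ofReal_le_ofReal ((h u hu v hv).trans ?_)
    exact mul_le_mul_of_nonneg_right (Real.le_coe_toNNReal C) (by positivity)
  have := hold.dimH_image_le hE'
  rwa [hinj.leftInvOn_invFunOn.image_image, ENNReal.coe_inv hE.ne', div_eq_mul_inv, inv_inv,
    mul_comm] at this

lemma sub_le_of_agree {p u v x : ℝ} (hx : 0 < x) (hp : 1 < p) (hpu : p ≤ u)
    (huv : u ≤ v) {c d : Digits M} (hc : piQ M u c = x) (hd : piQ M v d = x) {n : ℕ}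
    (h : ∀ i < n, c i = d i) : v - u ≤ v * (M / (p - 1)) / x * (p⁻¹) ^ n := by
  have hv : 1 < v := by linarith
  have h1 := piQ_scale (hp.trans_le hpu) huv c
  have h2 := (abs_le.1 (abs_piQ_sub_le hv h)).1
  have h3 : (M : ℝ) / (v - 1) * (v⁻¹) ^ n ≤ M / (p - 1) * (p⁻¹) ^ n := by
    have : 0 < p - 1 := by linarith
    have : p ≤ v := by linarith
    gcongr
  rw [hc] at h1
  rw [hd] at h2
  have h4 : v * (x - piQ M v c) ≤ v * (M / (p - 1) * (p⁻¹) ^ n) :=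
    mul_le_mul_of_nonneg_left (by linarith) (by linarith)
  rw [div_mul_eq_mul_div, le_div_iff₀ hx]
  linarith

lemma le_abs_piQ_sub {q r u v : ℝ} (hu1 : 1 < u) (hur : u ≤ r) (hv1 : 1 < v) (hvr : v ≤ r)
    (hrq : r < q) (hqM : q ≤ M + 1) {c d : Digits M} (hc : c ∈ UqSym M u) (hd : d ∈ UqSym M v)
    {n : ℕ} (h : ∀ i < n, c i = d i) (hne : c n ≠ d n) :
    (1 - r / q) / q * (q⁻¹) ^ n ≤ |piQ M q c - piQ M q d| := by
  wlog hlt : c n < d n generalizing c d u v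
  · rw [abs_sub_comm]
    exact this hv1 hvr hu1 hur hd hc (fun i hi => (h i hi).symm) hne.symm
      (lt_of_le_of_ne (not_lt.1 hlt) hne.symm)
  have hq1 : 1 < q := by linarith
  have hq0 : 0 < q := by linarith
  have h1 := piQ_shift_lt_of_mem_UqSym hu1 (by linarith) hc (hlt.trans_le (Fin.le_last _))
  have h2 := piQ_scale hu1 (by linarith : u ≤ q) (shift (n + 1) c)
  have h3 : piQ M q (shift (n + 1) c) ≤ r / q := by
    rw [le_div_iff₀ hq0]
    nlinarith
  have h4 := piQ_sub_piQ_of_ne hq1 (fun i hi => (h i hi).symm)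
  have h5 := piQ_nonneg hq1 (shift (n + 1) d)
  have h6 : ((c n : ℕ) : ℝ) + 1 ≤ (d n : ℕ) := by exact_mod_cast hlt
  rw [abs_sub_comm]
  refine le_trans ?_ (le_abs_self _)
  have h7 : (1 - r / q) / q * (q⁻¹) ^ n = (1 - r / q) / q ^ (n + 1) := by
    rw [inv_pow, pow_succ]
    field_simp
  rw [h7, div_le_iff₀ (by positivity), mul_comm, h4]
  linarith

/-- The univoque bases of `x` in `[p, r]` are a Hölder image of a subset of `𝒰_q` if `r < q`. -/
lemma dimH_Ubases_inter_Icc_le {x p r q : ℝ} {E : ℝ≥0} (hx : 0 < x) (hp : 1 < p)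
    (hrq : r < q) (hqM : q ≤ M + 1) (hE : 0 < E) (hpq : Real.log q ≤ E * Real.log p) :
    dimH (Ubases M x ∩ Set.Icc p r) ≤ E * dimH (Uq M q) := by
  have hex : ∀ u ∈ Ubases M x, ∃ c ∈ UqSym M u, piQ M u c = x := fun u hu =>
    exists_of_mem_Uq hu.2
  choose! c hc hcx using hex
  rcases (Ubases M x ∩ Set.Icc p r).eq_empty_or_nonempty with h0 | ⟨u₀, hu₀, hu₀'⟩
  · simp [h0]
  have hq1 : 1 < q := by linarith [hu₀'.1, hu₀'.2]
  have hq0 : 0 < q := by linarith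
  have hp0 : 0 < p := by linarith
  have hp1 : 0 < p - 1 := by linarith
  set A : ℝ := q * (M / (p - 1)) / x with hA
  set c₀ : ℝ := (1 - r / q) / q with hc₀
  have hc₀' : 0 < c₀ := div_pos (sub_pos.2 ((div_lt_one hq0).2 hrq)) hq0
  have hA0 : 0 ≤ A := by positivity
  set τ : ℝ := ((E⁻¹ : ℝ≥0) : ℝ) with hτ
  have hER : (0 : ℝ) < E := by exact_mod_cast hE
  have hτ0 : 0 < τ := by rw [hτ, NNReal.coe_inv]; positivity
  have hqp : p⁻¹ ≤ (q⁻¹) ^ τ := by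
    rw [Real.inv_rpow hq0.le, ← Real.log_le_log_iff (by positivity) (by positivity), Real.log_inv,
      Real.log_inv, Real.log_rpow hq0, neg_le_neg_iff, hτ, NNReal.coe_inv, inv_mul_le_iff₀ hER]
    exact hpq
  refine (dimH_le_of_abs_sub_le (C := A / c₀ ^ τ) hE (g := fun u => piQ M q (c u))
    fun u hu v hv => ?_).trans (mul_le_mul_right (dimH_mono ?_) _)
  · wlog huv : u ≤ v generalizing u v
    · rw [abs_sub_comm, abs_sub_comm (piQ M q (c u))]
      exact this v hv u hu (le_of_not_ge huv)
    obtain ⟨hu, hpu, hur⟩ := hu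
    obtain ⟨hv, hpv, hvr⟩ := hv
    by_cases he : c u = c v
    · have h1 := piQ_scale (hp.trans_le hpu) huv (c u)
      rw [hcx u hu, he, hcx v hv] at h1
      have : v ≤ u := le_of_mul_le_mul_right h1 hx
      rw [le_antisymm huv this, sub_self, abs_zero]
      positivity
    · have hne : ∃ n, c u n ≠ c v n := by
        by_contra hcon
        push Not at hcon
        exact he (funext hcon)
      have hmin : ∀ i < Nat.find hne, c u i = c v i := fun i hi =>
        not_not.1 (Nat.find_min hne hi)
      have h1 := sub_le_of_agree hx hp hpu huv (hcx u hu) (hcx v hv) hmin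
      have h2 := le_abs_piQ_sub (hp.trans_le hpu) hur (hp.trans_le hpv) hvr hrq hqM (hc u hu)
        (hc v hv) hmin (Nat.find_spec hne)
      set n := Nat.find hne
      rw [abs_sub_comm, abs_of_nonneg (sub_nonneg.2 huv)]
      calc v - u ≤ v * (M / (p - 1)) / x * (p⁻¹) ^ n := h1
        _ ≤ A * ((q⁻¹) ^ τ) ^ n := by
          rw [hA]
          have : v ≤ q := by linarith
          gcongr
        _ = A / c₀ ^ τ * (c₀ * (q⁻¹) ^ n) ^ τ := by
          have : c₀ ^ τ ≠ 0 := by positivity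
          rw [Real.mul_rpow hc₀'.le (by positivity), ← Real.rpow_natCast, ← Real.rpow_natCast,
            ← Real.rpow_mul (by positivity), ← Real.rpow_mul (by positivity), mul_comm τ]
          field_simp
        _ ≤ A / c₀ ^ τ * |piQ M q (c u) - piQ M q (c v)| ^ τ := by gcongr
  · rintro _ ⟨u, ⟨hu, hpu, hur⟩, rfl⟩
    exact piQ_mem_Uq (UqSym_mono (hp.trans_le hpu) (by linarith) (by linarith) (hc u hu))

lemma dimH_Ubases_le_iSup {x : ℝ} (hx : 0 < x) :
    dimH (Ubases M x) ≤ ⨆ q ∈ closure (Ubases M x), dimH (Uq M q) := by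
  set S := ⨆ q ∈ closure (Ubases M x), dimH (Uq M q) with hS
  have main : ∀ E : ℝ≥0, 1 < E → dimH (Ubases M x) ≤ E * S := by
    intro E hE
    have hE0 : 0 < E := one_pos.trans hE
    have hER : (1 : ℝ) < E := by exact_mod_cast hE
    set B : ℤ → Set ℝ := fun k =>
      Ubases M x ∩ {q | Real.log q ∈ Set.Ico ((E : ℝ) ^ k) ((E : ℝ) ^ (k + 1))} with hB
    have hsub : Ubases M x ⊆ ⋃ k, B k := by
      intro q hq
      obtain ⟨k, hk⟩ := exists_mem_Ico_zpow (Real.log_pos hq.1.1) hER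
      exact Set.mem_iUnion.2 ⟨k, hq, hk⟩
    refine (dimH_mono hsub).trans ?_
    rw [dimH_iUnion]
    refine iSup_le fun k => ?_
    rcases (B k).eq_empty_or_nonempty with h0 | hne
    · simp [h0]
    have hbdd : BddAbove (B k) := ⟨M + 1, fun q hq => hq.1.1.2⟩
    set q₀ := sSup (B k) with hq₀
    have hcl : q₀ ∈ closure (Ubases M x) :=
      closure_mono Set.inter_subset_left (csSup_mem_closure hne hbdd)
    have hqM : q₀ ≤ M + 1 := csSup_le hne fun q hq => hq.1.1.2
    have hEk : 0 < (E : ℝ) ^ k := by positivity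
    have hlog : Real.log q₀ ≤ E * Real.log (Real.exp ((E : ℝ) ^ k)) := by
      obtain ⟨q, hq⟩ := hne
      have hq0 : 0 < q₀ := (one_pos.trans hq.1.1.1).trans_le (le_csSup hbdd hq)
      rw [Real.log_exp, mul_comm, ← zpow_add_one₀ (by positivity), Real.log_le_iff_le_exp hq0]
      refine csSup_le ⟨q, hq⟩ fun q' hq' => ?_
      rw [← Real.log_le_iff_le_exp (one_pos.trans hq'.1.1.1)]
      exact hq'.2.2.le
    have hcov : B k ⊆ {q₀} ∪
        ⋃ n : ℕ, Ubases M x ∩ Set.Icc (Real.exp ((E : ℝ) ^ k)) (q₀ - 1 / (n + 1)) := by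
      intro q hq
      rcases (le_csSup hbdd hq).lt_or_eq with hlt | heq
      · obtain ⟨n, hn⟩ := exists_nat_one_div_lt (sub_pos.2 hlt)
        refine Or.inr (Set.mem_iUnion.2 ⟨n, hq.1, ?_, by linarith⟩)
        rw [← Real.le_log_iff_exp_le (one_pos.trans hq.1.1.1)]
        exact hq.2.1
      · exact Or.inl heq
    refine (dimH_mono hcov).trans ?_
    rw [dimH_union, dimH_singleton, dimH_iUnion]
    refine max_le (zero_le) (iSup_le fun n => ?_)
    refine (dimH_Ubases_inter_Icc_le hx (Real.one_lt_exp_iff.2 hEk)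
      (sub_lt_self _ (by positivity)) hqM hE0 hlog).trans ?_
    exact mul_le_mul_right (le_iSup₂ (f := fun q _ => dimH (Uq M q)) q₀ hcl) _
  have hlim : Filter.Tendsto (fun E : ℝ≥0 => (E : ℝ≥0∞) * S) (nhdsWithin 1 (Set.Ioi 1))
      (nhds ((1 : ℝ≥0) * S)) :=
    ENNReal.Tendsto.mul_const
      ((ENNReal.continuous_coe.tendsto 1).mono_left nhdsWithin_le_nhds) (Or.inl (by simp))
  rw [ENNReal.coe_one, one_mul] at hlim
  exact ge_of_tendsto hlim (Filter.eventually_of_mem self_mem_nhdsWithin main)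

/-! ### Porosity of `𝒰_q` -/

/-- If every interval of length at most `L` has a cell of its subdivision into `K` equal parts
that misses `E`, then `E` has dimension at most `log (K - 1) / log K`. -/
lemma dimH_le_of_porous {E : Set ℝ} {L : ℝ} {K : ℕ} (hL : 0 < L) (hK : 2 ≤ K)
    (hE : E ⊆ Set.Icc 0 L)
    (h : ∀ α ℓ : ℝ, 0 < ℓ → ℓ ≤ L → ∃ i < K,
      ∀ y ∈ E, y ∉ Set.Icc (α + i * (ℓ / K)) (α + (i + 1) * (ℓ / K)))
    {s : ℝ≥0} (hs : ((K : ℝ) - 1) * ((K : ℝ)⁻¹) ^ (s : ℝ) ≤ 1) : dimH E ≤ s := by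
  have hKR : (2 : ℝ) ≤ K := by exact_mod_cast hK
  have hK0 : (0 : ℝ) < K := by linarith
  have key : ∀ n : ℕ, ∃ t : Finset ℝ, t.card ≤ (K - 1) ^ n ∧
      E ⊆ ⋃ c ∈ t, Set.Icc c (c + L * ((K : ℝ)⁻¹) ^ n) := by
    intro n
    induction n with
    | zero => exact ⟨{0}, by simp, by simpa using hE⟩
    | succ n ih =>
      obtain ⟨t, ht, hEt⟩ := ih
      set ℓ := L * ((K : ℝ)⁻¹) ^ n with hℓ
      have hℓ0 : 0 < ℓ := by positivity
      have hℓL : ℓ ≤ L := mul_le_of_le_one_right hL.le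
        (pow_le_one₀ (by positivity) (inv_le_one_of_one_le₀ (by linarith)))
      choose i hiK hi using fun α => h α ℓ hℓ0 hℓL
      refine ⟨t.biUnion fun α => ((Finset.range K).erase (i α)).image
        fun j : ℕ => α + j * (ℓ / K), ?_, ?_⟩
      · refine (Finset.card_biUnion_le_card_mul _ _ (K - 1) fun α _ => ?_).trans ?_
        · refine Finset.card_image_le.trans ?_
          rw [Finset.card_erase_of_mem (Finset.mem_range.2 (hiK α)), Finset.card_range]
        · rw [pow_succ]
          exact Nat.mul_le_mul_right _ ht
      · intro y hy
        obtain ⟨α, hα, hαy, hyα⟩ := Set.mem_iUnion₂.1 (hEt hy)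
        have hδ : 0 < ℓ / K := by positivity
        have hcell : ∃ j < K, y ∈ Set.Icc (α + j * (ℓ / K)) (α + (j + 1) * (ℓ / K)) := by
          have e : (K : ℝ) * (ℓ / K) = ℓ := by field_simp
          rcases hyα.lt_or_eq with hlt | heq
          · have h0 : 0 ≤ (y - α) / (ℓ / K) := div_nonneg (by linarith) hδ.le
            have h1 := Nat.floor_le h0
            have h2 := Nat.lt_floor_add_one ((y - α) / (ℓ / K))
            rw [le_div_iff₀ hδ] at h1
            rw [div_lt_iff₀ hδ] at h2
            refine ⟨⌊(y - α) / (ℓ / K)⌋₊, ?_, by linarith, by linarith⟩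
            rw [Nat.floor_lt h0, div_lt_iff₀ hδ, e]
            linarith
          · refine ⟨K - 1, by omega, ?_⟩
            rw [Nat.cast_sub (by omega), Nat.cast_one, sub_add_cancel, e, heq]
            refine ⟨?_, le_refl _⟩
            rw [sub_mul, e]
            linarith
        obtain ⟨j, hjK, hj⟩ := hcell
        have hji : j ≠ i α := fun e => hi α y hy (e ▸ hj)
        refine Set.mem_iUnion₂.2 ⟨α + j * (ℓ / K), Finset.mem_biUnion.2 ⟨α, hα,
          Finset.mem_image.2 ⟨j, Finset.mem_erase.2 ⟨hji, Finset.mem_range.2 hjK⟩, rfl⟩⟩, hj.1, ?_⟩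
        have e : L * ((K : ℝ)⁻¹) ^ (n + 1) = ℓ / K := by rw [pow_succ, ← mul_assoc]; rfl
        rw [e]
        linarith [hj.2]
  refine dimH_le_of_forall_cover (θ := (K : ℝ)⁻¹) (C := 1) (C' := L) (by positivity)
    (inv_lt_one_of_one_lt₀ (by linarith)) hL.le fun n => ?_
  obtain ⟨t, ht, hEt⟩ := key n
  refine ⟨t, ?_, hEt⟩
  have ht' : (t.card : ℝ) ≤ ((K : ℝ) - 1) ^ n := by
    have : ((K - 1 : ℕ) : ℝ) = (K : ℝ) - 1 := by rw [Nat.cast_sub (by omega), Nat.cast_one]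
    rw [← this]
    exact_mod_cast ht
  have h0 : 0 ≤ ((K : ℝ) - 1) * ((K : ℝ)⁻¹) ^ (s : ℝ) :=
    mul_nonneg (by linarith) (by positivity)
  calc (t.card : ℝ) * (((K : ℝ)⁻¹) ^ (s : ℝ)) ^ n
      ≤ ((K : ℝ) - 1) ^ n * (((K : ℝ)⁻¹) ^ (s : ℝ)) ^ n := by gcongr
    _ = (((K : ℝ) - 1) * ((K : ℝ)⁻¹) ^ (s : ℝ)) ^ n := (mul_pow _ _ _).symm
    _ ≤ 1 := pow_le_one₀ h0 hs

/-- The first `n` digits of `d`, then the digit `a`, then `e`. -/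
def splice (d : Digits M) (n : ℕ) (a : Fin (M + 1)) (e : Digits M) : Digits M := fun i =>
  if i < n then d i else if i = n then a else e (i - (n + 1))

lemma splice_self (d : Digits M) (n : ℕ) (a : Fin (M + 1)) (e : Digits M) :
    splice d n a e n = a := by
  rw [splice, if_neg (lt_irrefl n), if_pos rfl]

lemma piQ_splice {q : ℝ} (hq : 1 < q) (d : Digits M) (n : ℕ) (a : Fin (M + 1)) (e : Digits M) :
    piQ M q (splice d n a e) =
      piQ M q d - piQ M q (shift n d) / q ^ n + (a + piQ M q e) / q ^ (n + 1) := by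
  have hq0 : q ≠ 0 := by positivity
  have h1 := piQ_sub_piQ hq (c := splice d n a e) (d := d) (n := n) fun i hi => if_pos hi
  have h2 := piQ_cons hq (shift n (splice d n a e))
  have h3 : shift 1 (shift n (splice d n a e)) = e := by
    funext i
    simp only [shift_apply, splice]
    rw [if_neg (by omega), if_neg (by omega)]
    congr 1
    omega
  rw [h3, shift_apply, zero_add, splice_self] at h2
  rw [← h2, pow_succ, mul_comm (q ^ n) q, mul_div_mul_left _ _ hq0]
  linear_combination h1

lemma exists_hole (hM : 0 < M) {q y : ℝ} (hq : 1 < q) (hqM : q ≤ M + 1) (hy : y ∈ Uq M q) (n : ℕ) :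
    ∃ c ≤ y, y ≤ c + M / (q - 1) / q ^ n ∧
      ∀ z ∈ Set.Icc (c + 1 / q ^ (n + 1)) (c + M / (q - 1) / q ^ (n + 1)), z ∉ Uq M q := by
  have hq0 : 0 < q := by linarith
  obtain ⟨d, -, rfl⟩ := exists_of_mem_Uq hy
  refine ⟨piQ M q d - piQ M q (shift n d) / q ^ n, ?_, ?_, ?_⟩
  · have : 0 ≤ piQ M q (shift n d) / q ^ n := div_nonneg (piQ_nonneg hq _) (by positivity)
    linarith
  · have : piQ M q (shift n d) / q ^ n ≤ M / (q - 1) / q ^ n := by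
      gcongr
      exact piQ_le hq _
    linarith
  · rintro z ⟨hz1, hz2⟩ ⟨f, -, hf⟩
    set c := piQ M q d - piQ M q (shift n d) / q ^ n with hc
    have hp : 0 < q ^ (n + 1) := by positivity
    have h1 : 1 ≤ (z - c) * q ^ (n + 1) := by
      rw [← div_le_iff₀ hp]
      linarith
    have h2 : (z - c) * q ^ (n + 1) ≤ M / (q - 1) := by
      rw [← le_div_iff₀ hp]
      linarith
    obtain ⟨e₀, he₀⟩ := exists_expansion hq hqM ⟨by linarith, h2⟩
    obtain ⟨e₁, he₁⟩ := exists_expansion (M := M) hq hqM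
      (y := (z - c) * q ^ (n + 1) - 1) ⟨by linarith, by linarith⟩
    have h3 : piQ M q (splice d n 0 e₀) = z := by
      rw [piQ_splice hq, he₀, ← hc]
      simp only [Fin.coe_ofNat_eq_mod, Nat.zero_mod, Nat.cast_zero, zero_add]
      rw [mul_div_cancel_right₀ _ hp.ne']
      ring
    have h4 : piQ M q (splice d n ⟨1, by omega⟩ e₁) = z := by
      rw [piQ_splice hq, he₁, ← hc]
      simp only [Nat.cast_one, add_sub_cancel]
      rw [mul_div_cancel_right₀ _ hp.ne']
      ring
    have h5 := congrFun ((hf _ h3).trans (hf _ h4).symm) n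
    rw [splice_self, splice_self, Fin.ext_iff] at h5
    simp at h5

/-- Every interval `[α, α + ℓ]` with `ℓ ≤ M / (q - 1)` has a subinterval that misses `𝒰_q`, of
length proportional to `ℓ` uniformly for `1 < q ≤ Q`. -/
lemma exists_hole_of_interval (hM : 0 < M) {Q q α ℓ : ℝ} (hQM : Q < M + 1) (hq : 1 < q)
    (hqQ : q ≤ Q) (hℓ : 0 < ℓ) (hℓL : ℓ ≤ M / (q - 1)) :
    ∃ β, α ≤ β ∧ β + (1 - (Q - 1) / M) / (3 * (M + 1) ^ 2) * ℓ ≤ α + ℓ ∧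
      ∀ z ∈ Uq M q, z ∉ Set.Icc β (β + (1 - (Q - 1) / M) / (3 * (M + 1) ^ 2) * ℓ) := by
  have hMR : (1 : ℝ) ≤ M := by exact_mod_cast hM
  have hq0 : 0 < q := by linarith
  have hq1 : 0 < q - 1 := by linarith
  set κ := (1 - (Q - 1) / M) / (3 * ((M : ℝ) + 1) ^ 2) with hκ
  set L := (M : ℝ) / (q - 1) with hL
  have hL0 : 0 < L := by positivity
  have hQ' : (q - 1) / M ≤ (Q - 1) / M := by gcongr
  have hQ1 : (Q - 1) / M < 1 := by rw [div_lt_one (by linarith)]; linarith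
  have hLinv : 1 / L = (q - 1) / M := by rw [hL, one_div_div]
  have hκ3 : κ ≤ 1 / 3 := by
    rw [hκ, div_le_div_iff₀ (by positivity) (by norm_num)]
    have : 0 ≤ (Q - 1) / M := div_nonneg (by linarith) (by linarith)
    nlinarith
  by_cases hmid : ∃ y ∈ Uq M q, y ∈ Set.Icc (α + ℓ / 3) (α + 2 * ℓ / 3)
  · obtain ⟨y, hy, hy1, hy2⟩ := hmid
    have hex : ∃ n : ℕ, L / q ^ n ≤ ℓ / 3 := by
      obtain ⟨n, hn⟩ := pow_unbounded_of_one_lt (L / (ℓ / 3)) hq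
      refine ⟨n, ?_⟩
      rw [div_le_iff₀ (by positivity)]
      rw [div_lt_iff₀ (by positivity)] at hn
      linarith
    set n := Nat.find hex with hn
    have h1 : L / q ^ n ≤ ℓ / 3 := Nat.find_spec hex
    have h2 : ℓ / 3 < L / q ^ n * q := by
      rcases Nat.eq_zero_or_pos n with h0 | hpos
      · rw [h0, pow_zero, div_one]
        nlinarith
      · have := not_le.1 (Nat.find_min hex (by omega : n - 1 < n))
        rw [← Nat.sub_add_cancel hpos, pow_succ, ← div_div, div_mul_cancel₀ _ hq0.ne']
        exact this
    obtain ⟨c, hcy, hyc, hc⟩ := exists_hole hM hq (by linarith) hy n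
    have h3 : L / q ^ (n + 1) ≤ L / q ^ n := by
      gcongr
      · exact hq.le
      · omega
    have h4 : 1 / q ^ (n + 1) + κ * ℓ ≤ L / q ^ (n + 1) := by
      have e : L / q ^ (n + 1) - 1 / q ^ (n + 1) = L / q ^ n * q * (1 - 1 / L) / q ^ 2 := by
        rw [pow_succ]
        field_simp
      have h5 : κ * ℓ = ℓ / 3 * (1 - (Q - 1) / M) / (M + 1) ^ 2 := by
        rw [hκ]
        field_simp
      have h6 : ℓ / 3 * (1 - (Q - 1) / M) / (M + 1) ^ 2 ≤
          L / q ^ n * q * (1 - 1 / L) / q ^ 2 := by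
        rw [hLinv]
        have : 0 ≤ 1 - (q - 1) / (M : ℝ) := by linarith
        have : q ≤ M + 1 := by linarith
        gcongr
      linarith
    have h7 : 0 < 1 / q ^ (n + 1) := by positivity
    refine ⟨c + 1 / q ^ (n + 1), by linarith, by linarith, fun z hz hz' => ?_⟩
    exact hc z ⟨hz'.1, by linarith [hz'.2]⟩ hz
  · push Not at hmid
    have h1 : κ * ℓ ≤ 1 / 3 * ℓ := mul_le_mul_of_nonneg_right hκ3 hℓ.le
    exact ⟨α + ℓ / 3, by linarith, by linarith, fun z hz hz' =>
      hmid z hz ⟨hz'.1, by linarith [hz'.2]⟩⟩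

lemma Uq_subset_Icc {q : ℝ} (hq : 1 < q) : Uq M q ⊆ Set.Icc 0 (M / (q - 1)) := by
  rintro y ⟨d, rfl, -⟩
  exact ⟨piQ_nonneg hq d, piQ_le hq d⟩

lemma exists_dimH_Uq_le (hM : 0 < M) {Q : ℝ} (hQM : Q < M + 1) :
    ∃ s : ℝ≥0, s < 1 ∧ ∀ q, 1 < q → q ≤ Q → dimH (Uq M q) ≤ s := by
  have hMR : (0 : ℝ) < M := by exact_mod_cast hM
  set κ := (1 - (Q - 1) / M) / (3 * ((M : ℝ) + 1) ^ 2) with hκ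
  have hκ0 : 0 < κ := by
    have hQ1 : (Q - 1) / M < 1 := by rw [div_lt_one hMR]; linarith
    have : 0 < 1 - (Q - 1) / M := by linarith
    positivity
  obtain ⟨K, hK⟩ := exists_nat_gt (max 3 (2 / κ))
  obtain ⟨hK3, hKκ⟩ := max_lt_iff.1 hK
  have hK0 : (0 : ℝ) < K := by linarith
  have hlogK : 0 < Real.log K := Real.log_pos (by linarith)
  have hlog : Real.log (K - 1) / Real.log K < 1 := by
    rw [div_lt_one hlogK]
    exact Real.log_lt_log (by linarith) (by linarith)
  have hlog0 : 0 ≤ Real.log (K - 1) / Real.log K :=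
    div_nonneg (Real.log_nonneg (by linarith)) hlogK.le
  obtain ⟨s, hs⟩ : ∃ s : ℝ≥0, (s : ℝ) = Real.log (K - 1) / Real.log K :=
    ⟨Real.toNNReal _, Real.coe_toNNReal _ hlog0⟩
  refine ⟨s, by rw [← NNReal.coe_lt_coe, hs]; exact hlog, fun q hq hqQ => ?_⟩
  have hq1 : 0 < q - 1 := by linarith
  refine dimH_le_of_porous (K := K) (div_pos hMR hq1)
    (by have : (2 : ℝ) < K := by linarith
        exact_mod_cast this.le) (Uq_subset_Icc hq) (fun α ℓ hℓ hℓL => ?_) ?_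
  · obtain ⟨β, hαβ, hβ, hhole⟩ := exists_hole_of_interval hM hQM hq hqQ hℓ hℓL (α := α)
    rw [← hκ] at hβ hhole
    have hδ : 0 < ℓ / K := by positivity
    have h0 : 0 ≤ (β - α) / (ℓ / K) := div_nonneg (by linarith) hδ.le
    have h1 := Nat.le_ceil ((β - α) / (ℓ / K))
    have h2 := Nat.ceil_lt_add_one h0
    set i := ⌈(β - α) / (ℓ / K)⌉₊
    rw [div_le_iff₀ hδ] at h1
    rw [← sub_lt_iff_lt_add, lt_div_iff₀ hδ] at h2
    have h3 : 2 * (ℓ / K) ≤ κ * ℓ := by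
      rw [div_lt_iff₀ hκ0] at hKκ
      rw [← mul_div_assoc, div_le_iff₀ hK0]
      nlinarith
    have h4 : ((i : ℝ) + 1) * (ℓ / K) < K * (ℓ / K) + ℓ / K := by
      have e : (K : ℝ) * (ℓ / K) = ℓ := by field_simp
      rw [e]
      linarith
    refine ⟨i, ?_, fun y hy hyi => hhole y hy ⟨by linarith [hyi.1], by linarith [hyi.2]⟩⟩
    have h5 : (i : ℝ) < K := by nlinarith
    exact_mod_cast h5
  · have h1 : ((K : ℝ)⁻¹) ^ (s : ℝ) = ((K : ℝ) - 1)⁻¹ := by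
      rw [Real.inv_rpow hK0.le, Real.rpow_def_of_pos hK0, hs, mul_div_cancel₀ _ hlogK.ne',
        Real.exp_log (by linarith)]
    rw [h1, mul_inv_cancel₀ (by linarith)]

lemma dimH_Uq_one : dimH (Uq M 1) = 0 := by
  refine Set.Countable.dimH_zero ((Set.countable_range ((↑) : ℕ → ℝ)).mono ?_)
  rintro _ ⟨d, rfl, -⟩
  by_cases hs : Summable fun i : ℕ => ((d i : ℕ) : ℝ) / 1 ^ (i + 1)
  · refine Nat.isClosedEmbedding_coe_real.isClosed_range.mem_of_tendsto
      hs.hasSum.tendsto_sum_nat (Filter.Eventually.of_forall fun n => ?_)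
    exact ⟨∑ i ∈ Finset.range n, (d i : ℕ), by simp⟩
  · exact ⟨0, by rw [piQ, tsum_eq_zero_of_not_summable hs, Nat.cast_zero]⟩

lemma closure_Ubases_subset (hM : 0 < M) {x Q : ℝ} (hQ : 1 < Q) (hx : M / (Q - 1) = x) :
    closure (Ubases M x) ⊆ Set.Icc 1 Q := by
  have hMR : (0 : ℝ) < M := by exact_mod_cast hM
  refine closure_minimal (fun q hq => ⟨hq.1.1.le, ?_⟩) isClosed_Icc
  have h1 := (Uq_subset_Icc hq.1.1 hq.2).2
  by_contra hlt
  have : (M : ℝ) / (q - 1) < M / (Q - 1) :=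
    div_lt_div_of_pos_left hMR (by linarith) (by linarith)
  linarith

end

/-- For every `x ∈ (1, x_KL)`:
`0 < dim_H 𝒰_{q_x} ≤ dim_H 𝒰(x) ≤ sup_{q ∈ cl(𝒰(x))} dim_H 𝒰_q < 1`
(Euclidean Hausdorff dimension of subsets of `ℝ`). -/
theorem dimH_Ubases_chain (M : ℕ) (hM : 0 < M) (x : ℝ)
    (hx : x ∈ Set.Ioo (1 : ℝ) (xKL M)) :
    0 < dimH (Uq M (qx M x)) ∧
    dimH (Uq M (qx M x)) ≤ dimH (Ubases M x) ∧
    dimH (Ubases M x) ≤ (⨆ q ∈ closure (Ubases M x), dimH (Uq M q)) ∧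
    (⨆ q ∈ closure (Ubases M x), dimH (Uq M q)) < 1 := by
  obtain ⟨hQ, hQM, hQx, p, hp, hpQ⟩ := qx_spec hM hx
  obtain ⟨a, hpa, ha1, ha2⟩ := exists_univoque_expansion_one hM hp
  obtain ⟨b, hb⟩ := exists_isQG hQ hQM.le
  have hab := hb.lexLt_of_lt hp.1.1 hpQ hpa
  have hbm : lexLt (mirror b) b :=
    (((mirror_lexLt.2 hab).le.trans_lt (ha2 1 (le_refl _))).trans_le (ha1 1)).trans_le hab.le
  refine ⟨dimH_Uq_pos hQ hb ha1 ha2 hab, dimH_Uq_le_dimH_Ubases hM hQ hQM.le hQx hb hbm,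
    dimH_Ubases_le_iSup (one_pos.trans hx.1), ?_⟩
  obtain ⟨s, hs, hdim⟩ := exists_dimH_Uq_le hM hQM
  refine lt_of_le_of_lt (iSup₂_le fun q hq => ?_) (ENNReal.coe_lt_one_iff.2 hs)
  obtain ⟨hq1, hqQ⟩ := closure_Ubases_subset hM hQ hQx hq
  rcases hq1.lt_or_eq with hlt | rfl
  · exact hdim q hlt hqQ
  · rw [dimH_Uq_one]
    exact zero_le

end Expansions
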